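/- arXiv:2108.10384 — 4 statements merged into one kernel-verified Lean document; each statement's English description precedes it below -/
import Mathlib

section
/- The dicyclic group Dic₆ of order 24 satisfies α(Dic₆) = 25. -/
/-- `graphAlpha G` is the minimum number of vertices of a finite simple graph whose
automorphism group is isomorphic to `G`. -/
noncomputable def graphAlpha (G : Type*) [Group G] : ℕ :=
  sInf {n : ℕ | ∃ Γ : SimpleGraph (Fin n), Nonempty ((Γ ≃g Γ) ≃* G)}

/-- The cyclic group of order `n`. -/
abbrev Cyc (n : ℕ) := Multiplicative (ZMod n)

namespace DicyclicSix

open QuaternionGroup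

/-! ### Lower bound -/

section LowerBound

section OrderThree

variable {V : Type*} {Γ : SimpleGraph V} {c : V → V}

theorem exists_involution_of_one_cycle (hadj : ∀ p q, Γ.Adj (c p) (c q) ↔ Γ.Adj p q)
    (hc3 : ∀ p, c (c (c p)) = p) {x : V} (hx : c x ≠ x)
    (hM : ∀ y, c y ≠ y → y = x ∨ y = c x ∨ y = c (c x)) :
    ∃ σ : V → V, (∀ p, σ (σ p) = p) ∧ (∀ p q, Γ.Adj p q → Γ.Adj (σ p) (σ q)) ∧
      (∃ p, σ p ≠ p) ∧ ∀ p, c p = p → σ p = p := by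
  classical
  have hne : c (c x) ≠ c x := fun h => hx (by grind)
  refine ⟨fun p => if p = c x then c (c x) else if p = c (c x) then c x else p, ?_, ?_, ?_, ?_⟩
  · intro p
    grind
  · intro p q h
    have := Γ.adj_comm
    by_cases hp : c p = p <;> by_cases hq : c q = q
    all_goals grind
  · exact ⟨c x, by simpa using hne⟩
  · intro p hp
    grind

theorem exists_involution_of_two_cycles (hadj : ∀ p q, Γ.Adj (c p) (c q) ↔ Γ.Adj p q)
    (hc3 : ∀ p, c (c (c p)) = p) {x y : V} (hx : c x ≠ x) (hy : c y ≠ y)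
    (hxy : y ≠ x ∧ y ≠ c x ∧ y ≠ c (c x)) (hs : Γ.Adj x (c y) ↔ Γ.Adj x (c (c y)))
    (hM : ∀ z, c z ≠ z →
      (z = x ∨ z = c x ∨ z = c (c x)) ∨ z = y ∨ z = c y ∨ z = c (c y)) :
    ∃ σ : V → V, (∀ p, σ (σ p) = p) ∧ (∀ p q, Γ.Adj p q → Γ.Adj (σ p) (σ q)) ∧
      (∃ p, σ p ≠ p) ∧ ∀ p, c p = p → σ p = p := by
  classical
  have hx2 : c (c x) ≠ c x := fun h => hx (by grind)
  have hy2 : c (c y) ≠ c y := fun h => hy (by grind)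
  refine ⟨fun p => if p = c x then c (c x) else if p = c (c x) then c x else
    if p = c y then c (c y) else if p = c (c y) then c y else p, ?_, ?_, ?_, ?_⟩
  · intro p
    grind
  · intro p q h
    have := Γ.adj_comm
    by_cases hp : c p = p <;> by_cases hq : c q = q
    · grind
    · rcases hM q hq with (rfl | rfl | rfl) | rfl | rfl | rfl <;> grind
    · rcases hM p hp with (rfl | rfl | rfl) | rfl | rfl | rfl <;> grind
    · rcases hM q hq with (rfl | rfl | rfl) | rfl | rfl | rfl <;>
      rcases hM p hp with (h | h | h) | h | h | h <;> subst h <;> grind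
  · exact ⟨c x, by simpa using hx2⟩
  · intro p hp
    grind

theorem exists_involution_of_card_le [Fintype V] [DecidableEq V]
    (hadj : ∀ p q, Γ.Adj (c p) (c q) ↔ Γ.Adj p q)
    (hc3 : ∀ p, c (c (c p)) = p) {x : V} (hx : c x ≠ x)
    (hM : (Finset.univ.filter fun x => c x ≠ x).card ≤ 8) :
    ∃ σ : V → V, (∀ p, σ (σ p) = p) ∧ (∀ p q, Γ.Adj p q → Γ.Adj (σ p) (σ q)) ∧
      (∃ p, σ p ≠ p) ∧ ∀ p, c p = p → σ p = p := by
  by_cases h1 : ∀ y, c y ≠ y → y = x ∨ y = c x ∨ y = c (c x)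
  · exact exists_involution_of_one_cycle hadj hc3 hx h1
  push Not at h1
  obtain ⟨y, hy, hxy, hs⟩ : ∃ y, c y ≠ y ∧ (y ≠ x ∧ y ≠ c x ∧ y ≠ c (c x)) ∧
      (Γ.Adj x (c y) ↔ Γ.Adj x (c (c y))) := by
    obtain ⟨y, hy, hxy⟩ := h1
    by_cases h2 : Γ.Adj x (c y) ↔ Γ.Adj x (c (c y))
    · exact ⟨y, hy, hxy, h2⟩
    by_cases h3 : Γ.Adj x y ↔ Γ.Adj x (c (c y))
    · exact ⟨c y, by grind, by grind, by rw [hc3, h3]⟩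
    · exact ⟨c (c y), by grind, by grind, by rw [hc3]; tauto⟩
  refine exists_involution_of_two_cycles hadj hc3 hx hy hxy hs ?_
  by_contra! h
  obtain ⟨z, hz, hxz, hyz⟩ := h
  have hcard : ∀ u, c u ≠ u → ({u, c u, c (c u)} : Finset V).card = 3 := fun u hu =>
    Finset.card_eq_three.2 ⟨u, c u, c (c u), hu.symm, by grind, by grind, rfl⟩
  have hdisj : ∀ u t, (t ≠ u ∧ t ≠ c u ∧ t ≠ c (c u)) →
      Disjoint ({u, c u, c (c u)} : Finset V) {t, c t, c (c t)} := by
    intro u t h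
    simp only [Finset.disjoint_left, Finset.mem_insert, Finset.mem_singleton]
    grind
  have hsub : ({x, c x, c (c x)} ∪ {y, c y, c (c y)} ∪ {z, c z, c (c z)} : Finset V) ⊆
      Finset.univ.filter fun x => c x ≠ x := by
    intro u
    simp only [Finset.mem_union, Finset.mem_insert, Finset.mem_singleton, Finset.mem_filter,
      Finset.mem_univ, true_and]
    grind
  have := Finset.card_le_card hsub
  rw [Finset.card_union_of_disjoint
      (Finset.disjoint_union_left.2 ⟨hdisj x z hxz, hdisj y z hyz⟩),
    Finset.card_union_of_disjoint (hdisj x y hxy), hcard x hx, hcard y hy, hcard z hz] at this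
  omega

end OrderThree

theorem eq_one_or_eq_of_mul_self :
    ∀ g : QuaternionGroup 6, g * g = 1 → g = 1 ∨ g = a 6 := by decide

theorem stabilizer_dichotomy :
    ∀ g : QuaternionGroup 6, g = 1 ∨ g = a 4 ∨ g = a 8 ∨ ∃ k : Fin 12, g ^ (k : ℕ) = a 6 := by
  decide +kernel

theorem a_six_mul_comm : ∀ g : QuaternionGroup 6, a 6 * g = g * a 6 := by decide

theorem a_four_mul :
    ∀ g : QuaternionGroup 6, a 4 * g = g * a 4 ∨ a 4 * g = g * (a 4 * a 4) := by decide

theorem exists_exchange (i j : ZMod 12) : ∃ h : QuaternionGroup 6,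
    h * xa j = a i ∧ h * a i = a 6 * xa j := by
  refine ⟨a i * a 6 * (a i)⁻¹ * xa j * (a i)⁻¹, ?_⟩
  revert i j
  decide +kernel

/-- A Sylow `2`-subgroup of `Dic₆`, which is a quaternion group. -/
def sylowTwo : Finset (QuaternionGroup 6) := {a 0, a 3, a 6, a 9, xa 0, xa 3, xa 6, xa 9}

theorem card_sylowTwo : sylowTwo.card = 8 := by decide

theorem eq_of_mem_sylowTwo : ∀ g ∈ sylowTwo, ∀ h ∈ sylowTwo,
    g⁻¹ * h = 1 ∨ g⁻¹ * h = a 4 ∨ g⁻¹ * h = a 8 → g = h := by decide +kernel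

variable {V : Type*} {Γ : SimpleGraph V} (r : QuaternionGroup 6 ≃* (Γ ≃g Γ))

theorem map_mul_apply (g h : QuaternionGroup 6) (v : V) : r (g * h) v = r g (r h v) := by
  rw [map_mul]; rfl

theorem map_one_apply (v : V) : r 1 v = v := by rw [map_one]; rfl

theorem involutive_eq {σ : V → V} (hσ : ∀ v, σ (σ v) = v)
    (hadj : ∀ v w, Γ.Adj v w → Γ.Adj (σ v) (σ w)) :
    (∀ v, σ v = v) ∨ ∀ v, σ v = r (a 6) v := by
  let φ : Γ ≃g Γ :=
    { toFun := σ, invFun := σ, left_inv := hσ, right_inv := hσ,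
      map_rel_iff' := fun {v w} => ⟨fun h => by simpa [hσ] using hadj _ _ h, hadj v w⟩ }
  have hφ : φ * φ = 1 := RelIso.ext hσ
  have h1 : ∀ v, φ v = r (r.symm φ) v := fun v => by rw [r.apply_symm_apply]
  rcases eq_one_or_eq_of_mul_self (r.symm φ) (by rw [← map_mul, hφ, map_one]) with h | h
  · left
    intro v
    exact (h1 v).trans (by rw [h, map_one_apply])
  · right
    intro v
    exact (h1 v).trans (by rw [h])

theorem a_six_apply_ne {v : V} (hv : r (a 6) v ≠ v) (g : QuaternionGroup 6) :
    r (a 6) (r g v) ≠ r g v := by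
  rw [← map_mul_apply, a_six_mul_comm, map_mul_apply]
  exact fun h => hv ((r g).injective h)

theorem stabilizer_of_ne {v : V} (hv : r (a 6) v ≠ v) {g : QuaternionGroup 6} (hg : r g v = v) :
    g = 1 ∨ g = a 4 ∨ g = a 8 := by
  rcases stabilizer_dichotomy g with h | h | h | ⟨k, hk⟩
  · exact Or.inl h
  · exact Or.inr (Or.inl h)
  · exact Or.inr (Or.inr h)
  · refine absurd ?_ hv
    rw [← hk]
    generalize (k : ℕ) = n
    induction n with
    | zero => rw [pow_zero, map_one_apply]
    | succ n ih => rw [pow_succ, map_mul_apply, hg, ih]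

theorem apply_eq_apply {v : V} {g h : QuaternionGroup 6} (hgh : r g v = r h v) :
    r (g⁻¹ * h) v = v := by
  rw [map_mul_apply, ← hgh, ← map_mul_apply, inv_mul_cancel, map_one_apply]

theorem exists_second_orbit :
    ∃ v w, r (a 6) v ≠ v ∧ r (a 6) w ≠ w ∧ ∀ g, r g v ≠ w := by
  classical
  obtain ⟨v, hv⟩ : ∃ v, r (a 6) v ≠ v := by
    by_contra! h
    have : r (a 6) = r 1 := RelIso.ext fun v => by rw [h, map_one_apply]
    exact absurd (r.injective this) (by decide)
  refine ⟨v, ?_⟩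
  by_contra! hw
  have hz : ∀ x, r (a 6) (r (a 6) x) = x := fun x => by
    rw [← map_mul_apply, show (a 6 * a 6 : QuaternionGroup 6) = 1 by decide, map_one_apply]
  have hB : ∀ x, (∃ j, r (xa j) v = r (a 6) x) ↔ ∃ j, r (xa j) v = x := by
    intro x
    constructor
    · rintro ⟨j, hj⟩
      exact ⟨j - 6, by rw [← a_mul_xa, map_mul_apply, hj, hz]⟩
    · rintro ⟨j, hj⟩
      exact ⟨j - 6, by rw [← a_mul_xa, map_mul_apply, hj]⟩
  have hAB : ∀ i j, r (a i) v ≠ r (xa j) v := by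
    intro i j h
    have := stabilizer_of_ne r hv (apply_eq_apply r h)
    revert this
    clear h
    revert i j
    decide +kernel
  have key : ∀ x y, (∃ j, r (xa j) v = x) → (¬ ∃ j, r (xa j) v = y) → Γ.Adj x y →
      Γ.Adj (r (a 6) x) y := by
    rintro x y ⟨j, rfl⟩ hy hxy
    by_cases hzy : r (a 6) y = y
    · rw [← hzy]
      exact (r (a 6)).map_rel_iff.2 hxy
    · obtain ⟨g, rfl⟩ := hw y hv hzy
      rcases g with i | i
      · obtain ⟨h, h1, h2⟩ := exists_exchange i j
        have h3 : r (a i) v = r h (r (xa j) v) := by rw [← map_mul_apply, h1]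
        rw [← map_mul_apply, ← h2, map_mul_apply]
        nth_rewrite 2 [h3]
        exact (r h).map_rel_iff.2 hxy.symm
      · exact absurd ⟨i, rfl⟩ hy
  let σ : V → V := fun x => if ∃ j, r (xa j) v = x then r (a 6) x else x
  rcases involutive_eq r (σ := σ) (fun x => by
      by_cases hx : ∃ j, r (xa j) v = x
      · simp only [σ, if_pos hx, if_pos ((hB x).2 hx), hz]
      · simp only [σ, if_neg hx]) (fun x y hxy => by
      by_cases hx : ∃ j, r (xa j) v = x <;> by_cases hy : ∃ j, r (xa j) v = y
      · simp only [σ, if_pos hx, if_pos hy]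
        exact (r (a 6)).map_rel_iff.2 hxy
      · simp only [σ, if_pos hx, if_neg hy]
        exact key x y hx hy hxy
      · simp only [σ, if_neg hx, if_pos hy]
        exact (key y x hy hx hxy.symm).symm
      · simpa only [σ, if_neg hx, if_neg hy]) with h | h
  · refine a_six_apply_ne r hv (xa 0) ?_
    simpa only [σ, if_pos (⟨0, rfl⟩ : ∃ j, r (xa j) v = r (xa 0) v)] using h (r (xa 0) v)
  · have hn : ¬ ∃ j, r (xa j) v = v := by
      rintro ⟨j, hj⟩
      exact hAB 0 j (by rw [a_zero, map_one_apply, hj])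
    have := h v
    simp only [σ, if_neg hn] at this
    exact hv this.symm

theorem a_four_apply_of_card_le [Fintype V] (hV : Fintype.card V ≤ 24) {v w : V}
    (hv : r (a 6) v ≠ v) (hw : ∀ g, r g v ≠ w) : r (a 4) v = v := by
  by_contra hc
  have hinj : Function.Injective fun g => r g v := by
    intro g h hgh
    have h1 := apply_eq_apply r hgh
    rcases stabilizer_of_ne r hv h1 with h2 | h2 | h2
    · exact inv_mul_eq_one.1 h2
    · exact absurd (h2 ▸ h1) hc
    · rw [h2] at h1
      refine absurd ?_ hc
      rw [show (a 4 : QuaternionGroup 6) = a 8 * a 8 by decide, map_mul_apply, h1, h1]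
  have := Fintype.card_lt_of_injective_of_notMem _ hinj (b := w) (by rintro ⟨g, hg⟩; exact hw g hg)
  rw [QuaternionGroup.card] at this
  omega

theorem a_four_apply_apply {v : V} (hc : r (a 4) v = v) (g : QuaternionGroup 6) :
    r (a 4) (r g v) = r g v := by
  rw [← map_mul_apply]
  rcases a_four_mul g with h | h <;> rw [h]
  · rw [map_mul_apply, hc]
  · rw [map_mul_apply, map_mul_apply, hc, hc]

theorem card_image_sylowTwo [DecidableEq V] {v : V} (hv : r (a 6) v ≠ v) :
    (sylowTwo.image fun g => r g v).card = 8 := by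
  rw [Finset.card_image_of_injOn, card_sylowTwo]
  intro g hg h hh hgh
  exact eq_of_mem_sylowTwo g hg h hh (stabilizer_of_ne r hv (apply_eq_apply r hgh))

theorem card_moved_le [Fintype V] [DecidableEq V] (hV : Fintype.card V ≤ 24) {v w : V}
    (hv : r (a 6) v ≠ v) (hw : r (a 6) w ≠ w) (hvw : ∀ g, r g v ≠ w)
    (hcv : r (a 4) v = v) (hcw : r (a 4) w = w) :
    (Finset.univ.filter fun x => r (a 4) x ≠ x).card ≤ 8 := by
  have h1 : Disjoint (sylowTwo.image fun g => r g v) (sylowTwo.image fun g => r g w) := by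
    simp only [Finset.disjoint_left, Finset.mem_image]
    rintro _ ⟨g, -, rfl⟩ ⟨h, -, hgh⟩
    refine hvw (h⁻¹ * g) ?_
    rw [map_mul_apply, ← hgh, ← map_mul_apply, inv_mul_cancel, map_one_apply]
  have h2 : Disjoint ((sylowTwo.image fun g => r g v) ∪ (sylowTwo.image fun g => r g w))
      (Finset.univ.filter fun x => r (a 4) x ≠ x) := by
    simp only [Finset.disjoint_left, Finset.mem_union, Finset.mem_image, Finset.mem_filter]
    rintro _ (⟨g, -, rfl⟩ | ⟨g, -, rfl⟩) ⟨-, h⟩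
    exacts [h (a_four_apply_apply r hcv g), h (a_four_apply_apply r hcw g)]
  have h3 := Finset.card_le_univ (((sylowTwo.image fun g => r g v) ∪
    (sylowTwo.image fun g => r g w)) ∪ Finset.univ.filter fun x => r (a 4) x ≠ x)
  rw [Finset.card_union_of_disjoint h2, Finset.card_union_of_disjoint h1,
    card_image_sylowTwo r hv, card_image_sylowTwo r hw] at h3
  omega

theorem not_card_le [Fintype V] (r : QuaternionGroup 6 ≃* (Γ ≃g Γ)) :
    ¬ Fintype.card V ≤ 24 := by
  classical
  intro hV
  obtain ⟨v, w, hv, hw, hvw⟩ := exists_second_orbit r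
  have hcv := a_four_apply_of_card_le r hV hv hvw
  have hcw := a_four_apply_of_card_le r hV hw (w := v) (fun g hg => hvw g⁻¹ <| by
    rw [← hg, ← map_mul_apply, inv_mul_cancel, map_one_apply])
  have hM := card_moved_le r hV hv hw hvw hcv hcw
  have hadj : ∀ p q, Γ.Adj (r (a 4) p) (r (a 4) q) ↔ Γ.Adj p q :=
    fun p q => (r (a 4)).map_rel_iff
  have hc3 : ∀ p, r (a 4) (r (a 4) (r (a 4) p)) = p := fun p => by
    rw [← map_mul_apply, ← map_mul_apply,
      show (a 4 * a 4 * a 4 : QuaternionGroup 6) = 1 by decide, map_one_apply]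
  have hinvol : ∀ σ : V → V, (∀ p, σ (σ p) = p) →
      (∀ p q, Γ.Adj p q → Γ.Adj (σ p) (σ q)) → σ v = v → ∀ p, σ p = p := by
    intro σ h1 h2 h3
    refine (involutive_eq r h1 h2).resolve_right fun h => hv ?_
    rw [← h, h3]
  obtain ⟨x, hx⟩ : ∃ x, r (a 4) x ≠ x := by
    by_contra! h
    have : r (a 4) = r 1 := RelIso.ext fun v => by rw [h, map_one_apply]
    exact absurd (r.injective this) (by decide)
  obtain ⟨σ, h1, h2, ⟨p, hp⟩, h3⟩ := exists_involution_of_card_le hadj hc3 hx hM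
  exact hp (hinvol σ h1 h2 (h3 v hcv) p)

end LowerBound

/-! ### Upper bound -/

section UpperBound

/-- Adjacency rows of a graph on `{0, …, 24}`, as bit masks. -/
def rows : List ℕ :=
  [2126, 4862005, 25444411, 1797, 4899110, 25434390, 25464449, 4877888, 3128, 4887752, 25437128,
   481, 41506, 21634, 41108, 21072, 3538944, 16843410, 4260964, 9437842, 19464192, 13697024,
   2359954, 2622564, 1180772]

/-- Adjacency of the graph given by `rows`. -/
def adj (i j : ℕ) : Bool := (rows.getD i 0).testBit j

/-- A graph on 25 vertices with automorphism group `Dic₆`. -/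
def graph : SimpleGraph (Fin 25) where
  Adj i j := adj i j = true
  symm := ⟨by decide +kernel⟩
  loopless := ⟨by decide +kernel⟩

/-- The action of `a 1` on the vertices. -/
def actA (v : ℕ) : ℕ :=
  [3, 9, 10, 8, 7, 6, 2, 1, 11, 4, 5, 0, 15, 12, 13, 14, 20, 19, 24, 22, 21, 16, 17, 18, 23].getD v 0

/-- The action of `xa 0` on the vertices. -/
def actB (v : ℕ) : ℕ :=
  [12, 5, 1, 13, 2, 4, 9, 6, 14, 10, 7, 15, 8, 11, 0, 3, 16, 18, 17, 23, 21, 20, 24, 19, 22].getD v 0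

theorem actA_lt (v : Fin 25) : actA v < 25 := by
  revert v; decide +kernel

theorem actB_lt (v : Fin 25) : actB v < 25 := by
  revert v; decide +kernel

/-- `actA` as an automorphism. -/
def autA : graph ≃g graph where
  toFun v := ⟨actA v, actA_lt v⟩
  invFun v := ⟨actA^[11] v, by revert v; decide +kernel⟩
  left_inv := by decide +kernel
  right_inv := by decide +kernel
  map_rel_iff' := by unfold graph; decide +kernel

/-- `actB` as an automorphism. -/
def autB : graph ≃g graph where
  toFun v := ⟨actB v, actB_lt v⟩
  invFun v := ⟨actB^[3] v, by revert v; decide +kernel⟩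
  left_inv := by decide +kernel
  right_inv := by decide +kernel
  map_rel_iff' := by unfold graph; decide +kernel

/-- The list `[f (k - 1), …, f 0]`. -/
def values (f : ℕ → ℕ) : ℕ → List ℕ
  | 0 => []
  | k + 1 => f k :: values f k

/-- Whether the partial automorphism `0, …, l.length - 1 ↦ l.reverse` extends by `k ↦ y`. -/
def compat (k y : ℕ) : List ℕ → Bool
  | [] => true
  | z :: l => (adj k l.length == adj y z) && !(y == z) && compat k y l

/-- Whether all extensions of `l` to an automorphism satisfy `leaf`. -/
def search (leaf : List ℕ → Bool) : ℕ → List ℕ → Bool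
  | 0, l => leaf l
  | m + 1, l => (List.range 25).all fun y => !(compat l.length y l) || search leaf m (y :: l)

/-- Whether `l` is the list of values of an element of the group generated by `actA` and `actB`. -/
def isWord (l : List ℕ) : Bool :=
  (List.range 12).any fun i => (l == values actA^[i] 25) || (l == values (actB ∘ actA^[i]) 25)

theorem search_isWord : search isWord 25 [] = true := by decide +kernel

theorem length_values (f : ℕ → ℕ) (k : ℕ) : (values f k).length = k := by
  induction k with
  | zero => rfl
  | succ k ih => simp [values, ih]

theorem eq_of_values_eq {f g : ℕ → ℕ} {k : ℕ} (h : values f k = values g k) :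
    ∀ i < k, f i = g i := by
  induction k with
  | zero => simp
  | succ k ih =>
    simp only [values, List.cons.injEq] at h
    intro i hi
    rcases Nat.lt_succ_iff_lt_or_eq.1 hi with hi | rfl
    exacts [ih h.2 i hi, h.1]

theorem compat_values {f : ℕ → ℕ} {k : ℕ}
    (hadj : ∀ i ≤ k, ∀ j ≤ k, adj i j = adj (f i) (f j))
    (hinj : ∀ i ≤ k, ∀ j ≤ k, f i = f j → i = j) :
    ∀ j ≤ k, compat k (f k) (values f j) = true := by
  intro j hj
  induction j with
  | zero => rfl
  | succ j ih =>
    have h1 := hadj k le_rfl j (by omega)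
    have h2 : f k ≠ f j := fun h => by have := hinj k le_rfl j (by omega) h; omega
    simp [values, compat, length_values, h1, h2, ih (by omega)]

theorem leaf_of_search {leaf : List ℕ → Bool} {f : ℕ → ℕ} (hlt : ∀ i < 25, f i < 25)
    (hadj : ∀ i < 25, ∀ j < 25, adj i j = adj (f i) (f j))
    (hinj : ∀ i < 25, ∀ j < 25, f i = f j → i = j) (m k : ℕ) (hmk : m + k = 25)
    (h : search leaf m (values f k) = true) : leaf (values f 25) = true := by
  induction m generalizing k with
  | zero => obtain rfl : k = 25 := by omega
            exact h
  | succ m ih =>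
    refine ih (k + 1) (by omega) ?_
    simp only [search, List.all_eq_true, List.mem_range] at h
    have := h (f k) (hlt k (by omega))
    rw [length_values, compat_values (fun i hi j hj => hadj i (by omega) j (by omega))
      (fun i hi j hj => hinj i (by omega) j (by omega)) k le_rfl] at this
    simpa [values] using this

theorem coe_autA_pow (i : ℕ) (v : Fin 25) : (((autA ^ i) v : Fin 25) : ℕ) = actA^[i] v := by
  induction i with
  | zero => rfl
  | succ i ih =>
    rw [pow_succ', Function.iterate_succ_apply', ← ih]
    rfl

theorem autA_pow_twelve : autA ^ 12 = 1 := by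
  ext v
  rw [coe_autA_pow]
  revert v
  decide +kernel

theorem autB_mul_self : autB * autB = autA ^ 6 := by
  ext v
  rw [coe_autA_pow]
  revert v
  decide +kernel

theorem autA_mul_autB_mul_autA : autA * autB * autA = autB := by
  ext v
  revert v
  decide +kernel

theorem eq_word (φ : graph ≃g graph) : ∃ i < 12, φ = autA ^ i ∨ φ = autB * autA ^ i := by
  let f : ℕ → ℕ := fun k => if h : k < 25 then φ ⟨k, h⟩ else k
  have hf : ∀ v : Fin 25, f v = φ v := fun v => by simp [f]
  have key := leaf_of_search (leaf := isWord) (f := f)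
    (fun i hi => by rw [hf ⟨i, hi⟩]; exact (φ _).2)
    (fun i hi j hj => by
      rw [hf ⟨i, hi⟩, hf ⟨j, hj⟩, Bool.eq_iff_iff]
      exact (φ.map_rel_iff (a := ⟨i, hi⟩) (b := ⟨j, hj⟩)).symm)
    (fun i hi j hj h => by
      rw [hf ⟨i, hi⟩, hf ⟨j, hj⟩] at h
      simpa using φ.injective (Fin.ext h)) 25 0 rfl search_isWord
  simp only [isWord, List.any_eq_true, List.mem_range, Bool.or_eq_true, beq_iff_eq] at key
  obtain ⟨i, hi, h | h⟩ := key
  · refine ⟨i, hi, Or.inl ?_⟩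
    ext v
    rw [coe_autA_pow, ← hf, eq_of_values_eq h v v.2]
  · refine ⟨i, hi, Or.inr ?_⟩
    ext v
    rw [← hf, eq_of_values_eq h v v.2, Function.comp_apply, ← coe_autA_pow]
    rfl

theorem autA_pow_val_add (i j : ZMod 12) :
    autA ^ (i + j).val = autA ^ i.val * autA ^ j.val := by
  rw [← pow_add, ZMod.val_add, ← pow_eq_pow_mod _ autA_pow_twelve]

theorem autA_pow_mul_autB (i : ℕ) : autA ^ i * autB * autA ^ i = autB := by
  induction i with
  | zero => simp
  | succ i ih =>
    calc autA ^ (i + 1) * autB * autA ^ (i + 1)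
        = autA ^ i * autA * autB * (autA * autA ^ i) := by rw [← pow_succ, ← pow_succ']
      _ = autA ^ i * (autA * autB * autA) * autA ^ i := by simp only [mul_assoc]
      _ = autB := by rw [autA_mul_autB_mul_autA, ih]

theorem autA_pow_mul_autB_mul (i j : ZMod 12) :
    autA ^ i.val * autB * autA ^ j.val = autB * autA ^ (j - i).val := by
  conv_lhs => rw [← add_sub_cancel i j, autA_pow_val_add, ← mul_assoc, autA_pow_mul_autB]

/-- The underlying function of the isomorphism from `Dic₆` to the automorphism group. -/
def toAut : QuaternionGroup 6 → (graph ≃g graph)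
  | a i => autA ^ ZMod.val (n := 12) i
  | xa i => autB * autA ^ ZMod.val (n := 12) i

/-- The action of `Dic₆` on the graph. -/
def toAutHom : QuaternionGroup 6 →* (graph ≃g graph) :=
  MonoidHom.mk' toAut <| by
    rintro (i | i) (j | j)
    · exact autA_pow_val_add i j
    · exact (autA_pow_mul_autB_mul i j).symm.trans (mul_assoc _ _ _)
    · exact (congrArg (autB * ·) (autA_pow_val_add i j)).trans (mul_assoc _ _ _).symm
    · change autA ^ (6 + j - i : ZMod 12).val =
        autB * autA ^ (ZMod.val (n := 12) i) * (autB * autA ^ (ZMod.val (n := 12) j))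
      rw [mul_assoc, ← mul_assoc (autA ^ _) autB, autA_pow_mul_autB_mul, ← mul_assoc,
        autB_mul_self, add_sub_assoc, autA_pow_val_add]
      rfl

theorem toAutHom_bijective : Function.Bijective toAutHom := by
  constructor
  · rw [injective_iff_map_eq_one]
    intro g hg
    have h : ∀ v, toAut g v = v := fun v => congrArg (fun φ : graph ≃g graph => φ v) hg
    clear hg
    revert g
    decide +kernel
  · intro φ
    obtain ⟨i, hi, rfl | rfl⟩ := eq_word φ
    · exact ⟨a (i : ZMod 12), congrArg (autA ^ ·) (ZMod.val_cast_of_lt hi)⟩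
    · exact ⟨xa (i : ZMod 12), congrArg (autB * autA ^ ·) (ZMod.val_cast_of_lt hi)⟩

end UpperBound

end DicyclicSix

/-- Proposition: the dicyclic group `Dic₆` of order 24 satisfies
`α(Dic₆) = 25`. -/
theorem alpha_dicyclic_six : graphAlpha (QuaternionGroup 6) = 25 := by
  refine IsLeast.csInf_eq ⟨⟨DicyclicSix.graph,
    ⟨(MulEquiv.ofBijective _ DicyclicSix.toAutHom_bijective).symm⟩⟩, ?_⟩
  rintro n ⟨Γ, ⟨e⟩⟩
  have := DicyclicSix.not_card_le e.symm
  rw [Fintype.card_fin] at this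
  omega
end

section
/- The group Q₈ × C₃ of order 24 satisfies α(Q₈ × C₃) = 25. -/
open QuaternionGroup

/-- The vertex set of the extremal graph: two regular `Q₈`-orbits and three regular `C₃`-orbits. -/
abbrev Vert := (Bool × QuaternionGroup 2) ⊕ (Fin 3 × Cyc 3)

/-- Connection sets between the `Q₈`-orbits. -/
def quatConn : Bool → Bool → List (QuaternionGroup 2)
  | false, false => [a 1, a 3]
  | true, true => [xa 0, xa 2]
  | false, true => [a 0, a 1, xa 0]
  | true, false => [a 0, a 3, xa 2]

/-- Connection sets between the `C₃`-orbits. -/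
def cycConn (i j : Fin 3) : List (Cyc 3) :=
  if i = j then (if i = 1 then [.ofAdd 1, .ofAdd 2] else [])
  else if i = 0 ∨ j = 0 then [1]
  else if i = 1 then [.ofAdd 1] else [.ofAdd 2]

/-- Adjacency of the extremal graph. -/
def vertAdj : Vert → Vert → Prop
  | .inl (i, x), .inl (j, y) => x⁻¹ * y ∈ quatConn i j
  | .inr (i, x), .inr (j, y) => x⁻¹ * y ∈ cycConn i j
  | .inl (i, _), .inr (j, _) => i = false ∧ j = 0
  | .inr (j, _), .inl (i, _) => i = false ∧ j = 0

instance : DecidableRel vertAdj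
  | .inl (i, x), .inl (j, y) => inferInstanceAs (Decidable (x⁻¹ * y ∈ quatConn i j))
  | .inr (i, x), .inr (j, y) => inferInstanceAs (Decidable (x⁻¹ * y ∈ cycConn i j))
  | .inl (i, _), .inr (j, _) => inferInstanceAs (Decidable (i = false ∧ j = 0))
  | .inr (j, _), .inl (i, _) => inferInstanceAs (Decidable (i = false ∧ j = 0))

/-- A graph on 25 vertices with automorphism group `Q₈ × C₃`. -/
def extremalGraph : SimpleGraph Vert where
  Adj := vertAdj
  symm := by
    have h : ∀ x y, vertAdj x y → vertAdj y x := by decide +kernel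
    exact ⟨h⟩
  loopless := by
    have h : ∀ x, ¬ vertAdj x x := by decide +kernel
    exact ⟨h⟩

instance : DecidableRel extremalGraph.Adj := inferInstanceAs (DecidableRel vertAdj)

/-- `Q₈ × C₃` acts on the extremal graph by left multiplication on each orbit. -/
def leftMulAut : QuaternionGroup 2 × Cyc 3 →* (extremalGraph ≃g extremalGraph) where
  toFun g :=
    { toEquiv := Equiv.sumCongr (Equiv.prodCongr (.refl _) (Equiv.mulLeft g.1))
        (Equiv.prodCongr (.refl _) (Equiv.mulLeft g.2))
      map_rel_iff' := by
        rintro (⟨i, x⟩ | ⟨i, x⟩) (⟨j, y⟩ | ⟨j, y⟩) <;>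
          simp [extremalGraph, vertAdj, mul_assoc] }
  map_one' := by ext (⟨i, x⟩ | ⟨i, x⟩) <;> simp
  map_mul' g h := by ext (⟨i, x⟩ | ⟨i, x⟩) <;> simp [mul_assoc]

/-- The orbit containing a vertex. -/
def orbitIndex : Vert → ℕ
  | .inl (i, _) => i.toNat
  | .inr (i, _) => i + 2

lemma orbitIndex_map (σ : extremalGraph ≃g extremalGraph) (v : Vert) :
    orbitIndex (σ v) = orbitIndex v := by
  have h : ∀ v w, extremalGraph.degree v = extremalGraph.degree w →
      orbitIndex v = orbitIndex w := by decide +kernel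
  exact h _ _ (σ.degree_eq v)

instance (v : Vert) (l : List Vert) : Decidable (v ∈ l) :=
  @List.instDecidableMemOfLawfulBEq _ instBEqOfDecidableEq inferInstance v l

/-- Two base points, and a vertex fixed by every automorphism fixing them. -/
def layer₀ : List Vert := [.inl (false, 1), .inl (true, a 1), .inr (0, 1)]

/-- Vertices separated by their adjacencies to the earlier layers. -/
def layer₁ : List Vert := [.inl (false, a 1), .inl (false, a 3), .inl (false, xa 1),
    .inr (1, 1), .inr (2, 1)]

/-- Vertices separated by their adjacencies to the earlier layers. -/
def layer₂ : List Vert := [.inl (false, a 2), .inl (false, xa 3), .inl (true, a 0),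
    .inl (true, a 2), .inl (true, a 3), .inl (true, xa 0), .inl (true, xa 1), .inl (true, xa 2),
    .inl (true, xa 3), .inr (1, .ofAdd 1), .inr (2, .ofAdd 2)]

/-- Vertices separated by their adjacencies to the earlier layers. -/
def layer₃ : List Vert := [.inl (false, xa 0), .inl (false, xa 2), .inr (0, .ofAdd 1),
    .inr (0, .ofAdd 2), .inr (1, .ofAdd 2), .inr (2, .ofAdd 1)]

/-- A vertex is fixed as soon as its adjacencies to fixed vertices single it out of its orbit. -/
lemma map_eq_self_of_mem_append {σ : extremalGraph ≃g extremalGraph} {T T' : List Vert}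
    (hT : ∀ t ∈ T, σ t = t)
    (h : ∀ v w, v ∈ T' → w ∉ T → orbitIndex w = orbitIndex v →
      (∀ t ∈ T, extremalGraph.Adj w t ↔ extremalGraph.Adj v t) → w = v) :
    ∀ t ∈ T ++ T', σ t = t := by
  intro v hv
  rcases List.mem_append.1 hv with hv | hv
  · exact hT v hv
  · by_cases hσ : σ v ∈ T
    · exact σ.injective (hT _ hσ)
    · refine h v _ hv hσ (orbitIndex_map σ v) fun t ht => ?_
      conv_lhs => rw [← hT t ht]
      exact σ.map_rel_iff

lemma eq_one_of_map_base {σ : extremalGraph ≃g extremalGraph}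
    (h0 : σ (.inl (false, 1)) = .inl (false, 1)) (h1 : σ (.inr (0, 1)) = .inr (0, 1)) :
    σ = 1 := by
  have h2 : σ (.inl (true, a 1)) = .inl (true, a 1) := by
    have key : ∀ v, orbitIndex v = 1 → extremalGraph.Adj v (.inl (false, 1)) →
        (∀ w, orbitIndex w = 1 → extremalGraph.Adj w (.inl (false, 1)) →
          ¬ extremalGraph.Adj v w) → v = .inl (true, a 1) := by decide +kernel
    have key' : extremalGraph.Adj (.inl (true, a 1)) (.inl (false, 1)) ∧
        ∀ w, orbitIndex w = 1 → extremalGraph.Adj w (.inl (false, 1)) →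
          ¬ extremalGraph.Adj (.inl (true, a 1)) w := by decide +kernel
    refine key _ (orbitIndex_map σ _) ?_ fun w hw hadj => ?_
    · rw [← h0, σ.map_rel_iff]
      exact key'.1
    · obtain ⟨w, rfl⟩ := σ.surjective w
      rw [orbitIndex_map] at hw
      rw [← h0, σ.map_rel_iff] at hadj
      rw [σ.map_rel_iff]
      exact key'.2 w hw hadj
  have hT₀ : ∀ t ∈ layer₀, σ t = t := by simp [layer₀, h0, h1, h2]
  have hT₁ := map_eq_self_of_mem_append (T' := layer₁) hT₀ (by decide +kernel)
  have hT₂ := map_eq_self_of_mem_append (T' := layer₂) hT₁ (by decide +kernel)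
  have hT₃ := map_eq_self_of_mem_append (T' := layer₃) hT₂ (by decide +kernel)
  have hall : ∀ v, v ∈ layer₀ ++ layer₁ ++ layer₂ ++ layer₃ := by decide +kernel
  ext v
  exact hT₃ v (hall v)

lemma bijective_leftMulAut : Function.Bijective leftMulAut := by
  constructor
  · refine (injective_iff_map_eq_one _).2 fun g hg => ?_
    have h0 := DFunLike.congr_fun hg (.inl (false, 1))
    have h1 := DFunLike.congr_fun hg (.inr (0, 1))
    simp [leftMulAut] at h0 h1
    exact Prod.ext h0 h1
  · intro σ
    have h0 : ∀ v, orbitIndex v = 0 → ∃ q, v = .inl (false, q) := by decide +kernel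
    have h1 : ∀ v, orbitIndex v = 2 → ∃ c, v = .inr (0, c) := by decide +kernel
    obtain ⟨q, hq⟩ := h0 _ (orbitIndex_map σ (.inl (false, 1)))
    obtain ⟨c, hc⟩ := h1 _ (orbitIndex_map σ (.inr (0, 1)))
    refine ⟨(q, c), ?_⟩
    rw [← inv_mul_eq_one, ← map_inv]
    apply eq_one_of_map_base
    · rw [RelIso.mul_apply, hq]
      simp [leftMulAut]
    · rw [RelIso.mul_apply, hc]
      simp [leftMulAut]

lemma exists_graph_fin_25 : ∃ Γ : SimpleGraph (Fin 25),
    Nonempty ((Γ ≃g Γ) ≃* QuaternionGroup 2 × Cyc 3) := by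
  let e : Vert ≃ Fin 25 := Fintype.equivFinOfCardEq (by decide +kernel)
  let ε := SimpleGraph.Iso.map e extremalGraph
  refine ⟨extremalGraph.map e.toEmbedding, ⟨MulEquiv.symm ?_⟩⟩
  exact (MulEquiv.ofBijective _ bijective_leftMulAut).trans
    { toFun σ := (ε.symm.trans σ).trans ε
      invFun σ := (ε.trans σ).trans ε.symm
      left_inv σ := by ext; simp
      right_inv σ := by ext; simp
      map_mul' σ τ := by ext; simp }

/-- The map `Q₈ → Q₈` sending the standard generators to `u` and `v`. -/
def quatMap (u v : QuaternionGroup 2) : QuaternionGroup 2 → QuaternionGroup 2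
  | a i => u ^ i.val
  | xa i => v * u ^ i.val

/-- Any two distinct elements of order four of `Q₈` are exchanged, up to inverses, by an automorphism
which inverts the elements outside the subgroups they generate. -/
lemma exists_mulAut_swap {q r : QuaternionGroup 2} (hq : q ^ 2 ≠ 1) (hr : r ^ 2 ≠ 1)
    (hqr : q ≠ r) : ∃ ψ : MulAut (QuaternionGroup 2), ∀ g,
      ψ g = g⁻¹ ∨ (g = q ∧ ψ g = r⁻¹) ∨ (g = r ∧ ψ g = q⁻¹) ∨ (g = q⁻¹ ∧ ψ g = r) ∨
        (g = r⁻¹ ∧ ψ g = q) := by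
  have key : ∀ q r : QuaternionGroup 2, q ^ 2 ≠ 1 → r ^ 2 ≠ 1 → q ≠ r → ∃ u v,
      (∀ g, quatMap u v g = g⁻¹ ∨ (g = q ∧ quatMap u v g = r⁻¹) ∨ (g = r ∧ quatMap u v g = q⁻¹) ∨
        (g = q⁻¹ ∧ quatMap u v g = r) ∨ (g = r⁻¹ ∧ quatMap u v g = q)) ∧
      (∀ x, quatMap u v x = 1 → x = 1) ∧
      ∀ x y, quatMap u v (x * y) = quatMap u v x * quatMap u v y := by
    decide +kernel
  obtain ⟨u, v, h, hinj, hmul⟩ := key q r hq hr hqr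
  let f := MonoidHom.mk' (quatMap u v) hmul
  have hf : Function.Injective f := (injective_iff_map_eq_one f).2 hinj
  exact ⟨MulEquiv.ofBijective f (Finite.injective_iff_bijective.1 hf), h⟩

/-- Every inverse-closed subset of `Q₈ × C₃` is invariant under a nontrivial automorphism. -/
lemma exists_mulAut_ne_one_invariant (S : QuaternionGroup 2 × Cyc 3 → Prop)
    (hS : ∀ g, S g⁻¹ ↔ S g) :
    ∃ φ : MulAut (QuaternionGroup 2 × Cyc 3), φ ≠ 1 ∧ ∀ g, S (φ g) ↔ S g := by
  classical
  suffices h : ∃ q r : QuaternionGroup 2, q ^ 2 ≠ 1 ∧ r ^ 2 ≠ 1 ∧ q ≠ r ∧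
      ∀ c, S (q, c) ↔ S (r, c) by
    obtain ⟨q, r, hq, hr, hqr, h⟩ := h
    obtain ⟨ψ, hψ⟩ := exists_mulAut_swap hq hr hqr
    refine ⟨MulEquiv.prodCongr ψ (MulEquiv.inv (Cyc 3)), fun h1 => ?_, fun ⟨g, c⟩ => ?_⟩
    · have h2 := congrArg Prod.snd (DFunLike.congr_fun h1 (1, Multiplicative.ofAdd 1))
      exact absurd h2 (by decide : (Multiplicative.ofAdd (1 : ZMod 3))⁻¹ ≠ Multiplicative.ofAdd 1)
    · have hinv : ∀ g c, S (g⁻¹, c⁻¹) ↔ S (g, c) := fun g c => hS (g, c)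
      have hinv' : ∀ g c, S (g, c⁻¹) ↔ S (g⁻¹, c) := fun g c => by simpa using hinv g⁻¹ c
      change S (ψ g, c⁻¹) ↔ _
      rcases hψ g with h' | ⟨rfl, h'⟩ | ⟨rfl, h'⟩ | ⟨rfl, h'⟩ | ⟨rfl, h'⟩ <;> rw [h']
      · exact hinv g c
      · rw [hinv, h]
      · rw [hinv, h]
      · rw [← h, hinv']
      · rw [h, hinv']
  let w : Cyc 3 := Multiplicative.ofAdd 1
  have hc : ∀ c : Cyc 3, c = 1 ∨ c = w ∨ c = w⁻¹ := by decide
  have h1 : ∀ q : QuaternionGroup 2, S (q⁻¹, 1) ↔ S (q, 1) := fun q => by simpa using hS (q, 1)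
  have hw : ∀ q : QuaternionGroup 2, S (q⁻¹, w) ↔ S (q, w⁻¹) := fun q => hS (q, w⁻¹)
  have hw' : ∀ q : QuaternionGroup 2, S (q⁻¹, w⁻¹) ↔ S (q, w) := fun q => hS (q, w)
  by_cases hsymm : ∃ q : QuaternionGroup 2, q ^ 2 ≠ 1 ∧ (S (q, w) ↔ S (q, w⁻¹))
  · obtain ⟨q, hq, hqw⟩ := hsymm
    refine ⟨q, q⁻¹, hq, by simpa using hq, fun h => hq ?_, fun c => ?_⟩
    · rw [pow_two]
      exact mul_eq_one_iff_eq_inv.2 h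
    · rcases hc c with rfl | rfl | rfl
      · exact (h1 q).symm
      · rw [hw, hqw]
      · rw [hw', hqw]
  · push Not at hsymm
    obtain ⟨⟨q, hq⟩, ⟨r, hr⟩, hqr, heq⟩ := Fintype.exists_ne_map_eq_of_card_lt
      (fun q : {q : QuaternionGroup 2 // q ^ 2 ≠ 1} =>
        (decide (S (q.1, 1)), decide (S (q.1, w)))) (by decide +kernel)
    simp only [Prod.mk.injEq, decide_eq_decide] at heq
    refine ⟨q, r, hq, hr, fun h => hqr (Subtype.ext h), fun c => ?_⟩
    have := hsymm q hq
    have := hsymm r hr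
    rcases hc c with rfl | rfl | rfl <;> tauto

section

variable {V : Type*} {Γ : SimpleGraph V}

lemma exists_perm_two_swaps [DecidableEq V] {p q r s : V} (hpr : p ≠ r) (hps : p ≠ s)
    (hqr : q ≠ r) (hqs : q ≠ s) : ∃ τ : Equiv.Perm V, τ p = q ∧ τ q = p ∧ τ r = s ∧ τ s = r ∧
      ∀ v, v ≠ p → v ≠ q → v ≠ r → v ≠ s → τ v = v := by
  refine ⟨Equiv.swap p q * Equiv.swap r s, ?_, ?_, ?_, ?_, fun v h1 h2 h3 h4 => ?_⟩ <;>
    simp only [Equiv.Perm.mul_apply, Equiv.swap_apply_def] <;> grind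

lemma nine_le_card_moved [Fintype V] [DecidableEq V] {c : V → V} (hc : ∀ v, c (c (c v)) = v)
    {u w t : V} (hu : c u ≠ u) (hw : c w ≠ w) (ht : c t ≠ t) (hwu : w ≠ u) (hwu' : w ≠ c u)
    (hwu'' : w ≠ c (c u)) (htu : t ≠ u) (htu' : t ≠ c u) (htu'' : t ≠ c (c u)) (htw : t ≠ w)
    (htw' : t ≠ c w) (htw'' : t ≠ c (c w)) : 9 ≤ Fintype.card {v // c v ≠ v} := by
  let O (x : V) : Finset V := {x, c x, c (c x)}
  have hinj : ∀ x y, c x = c y → x = y := fun x y h => by rw [← hc x, h, hc]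
  have hO : ∀ x, c x ≠ x → (O x).card = 3 := fun x hx =>
    Finset.card_eq_three.2 ⟨x, c x, c (c x), hx.symm, fun h => hx ((congrArg c h).trans (hc x)),
      fun h => hx (hinj _ _ h).symm, rfl⟩
  have hmem : ∀ x y, y ∈ O x ↔ y = x ∨ y = c x ∨ y = c (c x) := fun x y => by simp [O]
  have hmoved : ∀ x y, c x ≠ x → y ∈ O x → c y ≠ y := fun x y hx hy => by
    rw [hmem] at hy
    grind only
  have hdisj : ∀ x y, y ≠ x → y ≠ c x → y ≠ c (c x) → Disjoint (O x) (O y) :=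
    fun x y h0 h1 h2 => by
      rw [Finset.disjoint_left]
      intro z hx hy
      rw [hmem] at hx hy
      grind only
  have hsub : O u ∪ O w ∪ O t ⊆ Finset.univ.filter (fun v => c v ≠ v) := by
    intro x hx
    simp only [Finset.mem_filter, Finset.mem_univ, true_and]
    rcases Finset.mem_union.1 hx with hx | hx
    · rcases Finset.mem_union.1 hx with hx | hx
      · exact hmoved u x hu hx
      · exact hmoved w x hw hx
    · exact hmoved t x ht hx
  have hcard := Finset.card_le_card hsub
  rwa [Finset.card_union_of_disjoint (Finset.disjoint_union_left.2
    ⟨hdisj _ _ htu htu' htu'', hdisj _ _ htw htw' htw''⟩),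
    Finset.card_union_of_disjoint (hdisj _ _ hwu hwu' hwu''),
    hO u hu, hO w hw, hO t ht, ← Fintype.card_subtype] at hcard

/-- Reversing the direction of an automorphism `c` of order three about a set `B` of base points
preserves adjacency as soon as it preserves adjacency to the base points. -/
lemma adj_iff_of_reverses {c τ : V → V} {B : V → Prop} (hc : ∀ v, c (c (c v)) = v)
    (hadj : ∀ x y, Γ.Adj (c x) (c y) ↔ Γ.Adj x y)
    (hB : ∀ x, ∃ b, B b ∧ (x = b ∨ x = c b ∨ x = c (c b)))
    (hτ : ∀ b, B b → τ b = b ∧ τ (c b) = c (c b) ∧ τ (c (c b)) = c b)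
    (hsym : ∀ b b', B b → B b' → (Γ.Adj b (c b') ↔ Γ.Adj b (c (c b')))) (x y : V) :
    Γ.Adj (τ x) (τ y) ↔ Γ.Adj x y := by
  have hmove : ∀ x y, Γ.Adj (c x) y ↔ Γ.Adj x (c (c y)) := fun x y => by
    rw [← hadj x, hc]
  obtain ⟨b, hb, hx⟩ := hB x
  obtain ⟨d, hd, hy⟩ := hB y
  obtain ⟨b0, b1, b2⟩ := hτ b hb
  obtain ⟨d0, d1, d2⟩ := hτ d hd
  have := hsym b d hb hd
  rcases hx with rfl | rfl | rfl <;> rcases hy with rfl | rfl | rfl <;>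
    simp only [b0, b1, b2, d0, d1, d2, hadj, hmove, this]

/-- If a graph automorphism of order three moves at most eight vertices, then the graph has an
involutive automorphism supported on those vertices. -/
lemma exists_involution_of_card_moved_le [Fintype V] [DecidableEq V] (c : V → V)
    (hc : ∀ v, c (c (c v)) = v) (hadj : ∀ x y, Γ.Adj (c x) (c y) ↔ Γ.Adj x y)
    (hne : ∃ u, c u ≠ u) (hcard : Fintype.card {v // c v ≠ v} ≤ 8) :
    ∃ τ : Equiv.Perm V, (∃ t, τ t ≠ t) ∧ (∀ v, τ (τ v) = v) ∧ (∀ v, c v = v → τ v = v) ∧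
      ∀ x y, Γ.Adj (τ x) (τ y) ↔ Γ.Adj x y := by
  have hmove : ∀ x y, Γ.Adj (c x) y ↔ Γ.Adj x (c (c y)) := fun x y => by
    rw [← hadj x, hc]
  have hself : ∀ x, Γ.Adj x (c x) ↔ Γ.Adj x (c (c x)) := fun x => by
    rw [← hmove, Γ.adj_comm]
  have hfix : ∀ x y, c x = x → (Γ.Adj x (c y) ↔ Γ.Adj x (c (c y))) := fun x y hx => by
    rw [← hadj x (c y), hx]
  have hfix' : ∀ x y, c y = y → (Γ.Adj x (c y) ↔ Γ.Adj x (c (c y))) := fun x y hy => by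
    rw [hy, hy]
  obtain ⟨u, hu⟩ := hne
  have hcc : ∀ v, c v ≠ v → c (c v) ≠ v ∧ c (c v) ≠ c v := fun v hv => by grind
  by_cases h1 : ∀ v, c v ≠ v → v = u ∨ v = c u ∨ v = c (c u)
  · let τ := Equiv.swap (c u) (c (c u))
    have t0 : τ u = u := Equiv.swap_apply_of_ne_of_ne (by grind) (by grind)
    have t1 : τ (c u) = c (c u) := Equiv.swap_apply_left _ _
    have t2 : τ (c (c u)) = c u := Equiv.swap_apply_right _ _
    have t3 : ∀ v, c v = v → τ v = v := fun v hv =>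
      Equiv.swap_apply_of_ne_of_ne (by grind) (by grind)
    refine ⟨τ, ⟨c u, by grind⟩, Equiv.swap_apply_self _ _, t3,
      adj_iff_of_reverses (B := fun b => b = u ∨ c b = b) hc hadj (fun x => ?_) ?_ ?_⟩
    · by_cases hx : c x = x
      · exact ⟨x, .inr hx, .inl rfl⟩
      · exact ⟨u, .inl rfl, h1 x hx⟩
    · rintro b (rfl | hb)
      · exact ⟨t0, t1, t2⟩
      · simp only [hb, t3 b hb, and_self]
    · rintro b d (rfl | hb) (rfl | hd)
      exacts [hself _, hfix' _ _ hd, hfix _ _ hb, hfix _ _ hb]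
  · push Not at h1
    obtain ⟨w₀, hw₀, hne₀⟩ := h1
    obtain ⟨w, hw, hwu, hsym⟩ : ∃ w, c w ≠ w ∧ (w ≠ u ∧ w ≠ c u ∧ w ≠ c (c u)) ∧
        (Γ.Adj u (c w) ↔ Γ.Adj u (c (c w))) := by
      by_cases a0 : Γ.Adj u w₀ <;> by_cases a1 : Γ.Adj u (c w₀) <;>
        by_cases a2 : Γ.Adj u (c (c w₀)) <;>
        first
        | exact ⟨w₀, by grind, by grind, by grind⟩
        | exact ⟨c w₀, by grind, by grind, by grind⟩
        | exact ⟨c (c w₀), by grind, by grind, by grind⟩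
    have hsym' : Γ.Adj w (c u) ↔ Γ.Adj w (c (c u)) := by
      rw [← hmove, Γ.adj_comm, Γ.adj_comm (c w), hmove]
      exact hsym.symm
    obtain ⟨τ, t1, t2, s1, s2, hτ⟩ := exists_perm_two_swaps (p := c u) (q := c (c u)) (r := c w)
      (s := c (c w)) (by grind) (by grind) (by grind) (by grind)
    have t0 : τ u = u := hτ u (by grind) (by grind) (by grind) (by grind)
    have s0 : τ w = w := hτ w (by grind) (by grind) (by grind) (by grind)
    have t3 : ∀ v, c v = v → τ v = v := fun v hv =>
      hτ v (by grind) (by grind) (by grind) (by grind)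
    clear hτ
    have hB : ∀ x, ∃ b, (b = u ∨ b = w ∨ c b = b) ∧ (x = b ∨ x = c b ∨ x = c (c b)) := by
      by_contra! h
      obtain ⟨t, ht⟩ := h
      obtain ⟨x0, x1, x2⟩ := ht u (.inl rfl)
      obtain ⟨y0, y1, y2⟩ := ht w (.inr (.inl rfl))
      have h9 := nine_le_card_moved hc hu hw (fun h => (ht t (.inr (.inr h))).1 rfl)
        hwu.1 hwu.2.1 hwu.2.2 x0 x1 x2 y0 y1 y2
      omega
    have hτ : ∀ b, (b = u ∨ b = w ∨ c b = b) →
        τ b = b ∧ τ (c b) = c (c b) ∧ τ (c (c b)) = c b := by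
      rintro b (rfl | rfl | hb)
      · exact ⟨t0, t1, t2⟩
      · exact ⟨s0, s1, s2⟩
      · simp only [hb, t3 b hb, and_self]
    refine ⟨τ, ⟨c u, fun h => (hcc u hu).2 (t1.symm.trans h)⟩, fun x => ?_, t3,
      adj_iff_of_reverses hc hadj hB hτ ?_⟩
    · obtain ⟨b, hb, hx⟩ := hB x
      obtain ⟨h0, h1, h2⟩ := hτ b hb
      rcases hx with rfl | rfl | rfl <;> simp only [h0, h1, h2]
    · rintro b d (rfl | rfl | hb) (rfl | rfl | hd)
      exacts [hself _, hsym, hfix' _ _ hd, hsym', hself _, hfix' _ _ hd, hfix _ _ hb, hfix _ _ hb,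
        hfix _ _ hb]
end

lemma eq_one_or_eq_of_mul_self (g : QuaternionGroup 2 × Cyc 3) (hg : g * g = 1) :
    g = 1 ∨ g = (a 2, 1) := by
  revert g
  decide +kernel

section

variable {V : Type*} {Γ : SimpleGraph V} [MulAction (QuaternionGroup 2 × Cyc 3) V]

/-- A point with nontrivial stabilizer is fixed by the involution or by the elements of order
three. -/
lemma smul_eq_or_smul_eq_of_ne_one {g : QuaternionGroup 2 × Cyc 3} (hg : g ≠ 1) {x : V}
    (hx : g • x = x) :
    ((a 2, 1) : QuaternionGroup 2 × Cyc 3) • x = x ∨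
      ((1, .ofAdd 1) : QuaternionGroup 2 × Cyc 3) • x = x := by
  have key : ∀ g : QuaternionGroup 2 × Cyc 3, g ≠ 1 →
      ∃ k : Fin 12, g ^ k.val = (a 2, 1) ∨ g ^ k.val = (1, .ofAdd 1) := by decide +kernel
  obtain ⟨k, hk⟩ := key g hg
  have hpow : ∀ n : ℕ, g ^ n • x = x := fun n => by
    induction n with
    | zero => simp
    | succ n ih => rw [pow_succ, mul_smul, hx, ih]
  rcases hk with hk | hk
  · exact .inl (by simpa only [hk] using hpow k.val)
  · exact .inr (by simpa only [hk] using hpow k.val)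

/-- The action of `Q₈ × C₃` on `V` is faithful and its image is the automorphism group of `Γ`. -/
structure IsFullAction (Γ : SimpleGraph V) : Prop where
  adj_smul (g : QuaternionGroup 2 × Cyc 3) (x y : V) : Γ.Adj (g • x) (g • y) ↔ Γ.Adj x y
  eq_one (g : QuaternionGroup 2 × Cyc 3) (h : ∀ x : V, g • x = x) : g = 1
  exists_smul_eq (σ : Equiv.Perm V) (hσ : ∀ x y, Γ.Adj (σ x) (σ y) ↔ Γ.Adj x y) :
    ∃ g : QuaternionGroup 2 × Cyc 3, ∀ x, g • x = σ x

namespace IsFullAction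

/-- The only involutive automorphism is the one given by the central involution. -/
lemma smul_eq_of_involutive (h : IsFullAction Γ) {τ : Equiv.Perm V} (hτ : ∀ x, τ (τ x) = x)
    (hne : ∃ x, τ x ≠ x) (hadj : ∀ x y, Γ.Adj (τ x) (τ y) ↔ Γ.Adj x y) (x : V) :
    ((a 2, 1) : QuaternionGroup 2 × Cyc 3) • x = τ x := by
  obtain ⟨g, hg⟩ := h.exists_smul_eq τ hadj
  have hgg : g * g = 1 := h.eq_one _ fun x => by rw [mul_smul, hg, hg, hτ]
  rcases eq_one_or_eq_of_mul_self g hgg with rfl | rfl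
  · obtain ⟨x, hx⟩ := hne
    exact absurd ((hg x).symm.trans (one_smul _ x)) hx
  · exact hg x

/-- If `V` has at most 24 points, then no orbit is regular. -/
lemma smul_eq_or_smul_eq [Fintype V] (h : IsFullAction Γ) (hcard : Fintype.card V ≤ 24) (x : V) :
    ((a 2, 1) : QuaternionGroup 2 × Cyc 3) • x = x ∨
      ((1, .ofAdd 1) : QuaternionGroup 2 × Cyc 3) • x = x := by
  by_contra hx
  have hstab : ∀ g : QuaternionGroup 2 × Cyc 3, g • x = x → g = 1 := fun g hg => by
    by_contra hne
    exact hx (smul_eq_or_smul_eq_of_ne_one hne hg)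
  have hinj : Function.Injective fun g : QuaternionGroup 2 × Cyc 3 => g • x := fun g k hgk => by
    rw [← inv_mul_eq_one]
    apply hstab
    rw [mul_smul, ← show g • x = k • x from hgk, inv_smul_smul]
  have hle := Fintype.card_le_of_injective _ hinj
  have h24 : Fintype.card (QuaternionGroup 2 × Cyc 3) = 24 := by decide +kernel
  let o := Equiv.ofBijective _
    ((Fintype.bijective_iff_injective_and_card _).2 ⟨hinj, by omega⟩)
  have hS : ∀ g k : QuaternionGroup 2 × Cyc 3,
      Γ.Adj (g • x) (k • x) ↔ Γ.Adj x ((g⁻¹ * k) • x) := fun g k => by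
    rw [← h.adj_smul g⁻¹, inv_smul_smul, smul_smul]
  obtain ⟨φ, hφ, hφS⟩ := exists_mulAut_ne_one_invariant (fun g => Γ.Adj x (g • x)) fun g => by
    rw [← h.adj_smul g, smul_inv_smul, Γ.adj_comm]
  let σ : Equiv.Perm V := (o.symm.trans φ.toEquiv).trans o
  have hσ : ∀ g : QuaternionGroup 2 × Cyc 3, σ (g • x) = φ g • x := fun g => by
    change o (φ (o.symm (o g))) = o (φ g)
    rw [o.symm_apply_apply]
  have hadj : ∀ y z, Γ.Adj (σ y) (σ z) ↔ Γ.Adj y z := fun y z => by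
    obtain ⟨g, rfl⟩ := o.surjective y
    obtain ⟨k, rfl⟩ := o.surjective z
    change Γ.Adj (σ (g • x)) (σ (k • x)) ↔ Γ.Adj (g • x) (k • x)
    rw [hσ, hσ, hS, hS, ← map_inv, ← map_mul]
    exact hφS _
  obtain ⟨k, hk⟩ := h.exists_smul_eq σ hadj
  have hk1 : k = 1 := hstab k (by simpa using (hk x).trans (by simpa using hσ 1))
  refine hφ (MulEquiv.ext fun g => hinj ?_)
  change φ g • x = g • x
  rw [← hσ, ← hk, hk1, one_smul]

/-- A graph with at most 24 vertices has no full action of `Q₈ × C₃`. -/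
lemma card_gt [Fintype V] (h : IsFullAction Γ) : 24 < Fintype.card V := by
  classical
  by_contra! hcard
  let z : QuaternionGroup 2 × Cyc 3 := (a 2, 1)
  let c : QuaternionGroup 2 × Cyc 3 := (1, .ofAdd 1)
  have hz1 : z ≠ 1 := by decide
  have hc1 : c ≠ 1 := by decide
  have hor : ∀ v : V, z • v = v ∨ c • v = v := h.smul_eq_or_smul_eq hcard
  have hcomm : ∀ g : QuaternionGroup 2 × Cyc 3, z * g = g * z := by decide +kernel
  have hzc : ∀ v : V, z • v ≠ v → c • v = v := fun v hv => (hor v).resolve_left hv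
  have hzz : ∀ v : V, z • z • v = v := fun v => by
    rw [smul_smul, show z * z = 1 from by decide, one_smul]
  have hmove : ∀ (g : QuaternionGroup 2 × Cyc 3) (v : V), z • g • v = g • v → z • v = v :=
    fun g v hv => by
      rw [smul_smul, hcomm g, mul_smul] at hv
      exact smul_left_cancel g hv
  obtain ⟨x, hx⟩ : ∃ x : V, z • x ≠ x := by
    by_contra! hall
    exact hz1 (h.eq_one z hall)
  have hfree : ∀ v : V, z • v ≠ v → Function.Injective
      fun q : QuaternionGroup 2 => ((q, 1) : QuaternionGroup 2 × Cyc 3) • v := fun v hv p q hpq => by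
    by_contra hne
    have key : ∀ q : QuaternionGroup 2, q ≠ 1 → q = a 2 ∨ q * q = a 2 := by decide +kernel
    have hfix : ((p⁻¹ * q, 1) : QuaternionGroup 2 × Cyc 3) • v = v := by
      rw [show ((p⁻¹ * q, 1) : QuaternionGroup 2 × Cyc 3) = (p, 1)⁻¹ * (q, 1) by simp, mul_smul,
        ← show ((p, 1) : QuaternionGroup 2 × Cyc 3) • v = ((q, 1) : QuaternionGroup 2 × Cyc 3) • v
          from hpq, inv_smul_smul]
    rcases key (p⁻¹ * q) (fun h1 => hne (inv_mul_eq_one.1 h1)) with h1 | h1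
    · exact hv (by rwa [h1] at hfix)
    · apply hv
      rw [show z = (p⁻¹ * q, 1) * (p⁻¹ * q, 1) by simp [z, h1], mul_smul, hfix, hfix]
  by_cases horb : ∀ v : V, z • v ≠ v → ∃ q : QuaternionGroup 2,
      v = ((q, 1) : QuaternionGroup 2 × Cyc 3) • x
  · have hself : ∀ v, v ≠ x → v ≠ z • x → (Γ.Adj v (z • x) ↔ Γ.Adj v x) := fun v hvx hvz => by
      by_cases hv : z • v = v
      · conv_lhs => rw [← hv, h.adj_smul]
      · obtain ⟨q, rfl⟩ := horb v hv
        have key : ∀ q : QuaternionGroup 2, q = 1 ∨ q = a 2 ∨ q⁻¹ = q * a 2 := by decide +kernel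
        rcases key q with rfl | rfl | hq
        · exact absurd (one_smul _ x) hvx
        · exact absurd rfl hvz
        · rw [← h.adj_smul (q, 1)⁻¹, inv_smul_smul, Γ.adj_comm, smul_smul,
            show ((q, 1) : QuaternionGroup 2 × Cyc 3)⁻¹ * z = (q, 1) by
              simp [z, hq, mul_assoc, show (a 2 : QuaternionGroup 2) * a 2 = 1 from by decide]]
    have hadj : ∀ u v, Γ.Adj (Equiv.swap x (z • x) u) (Equiv.swap x (z • x) v) ↔ Γ.Adj u v := by
      have hsymm := Γ.adj_comm x (z • x)
      have hself' : ∀ v, v ≠ x → v ≠ z • x → (Γ.Adj (z • x) v ↔ Γ.Adj x v) := fun v h1 h2 => by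
        rw [Γ.adj_comm, hself v h1 h2, Γ.adj_comm]
      intro u v
      rcases eq_or_ne u x with rfl | hu
      · rcases eq_or_ne v u with rfl | hv
        · simp
        · rcases eq_or_ne v (z • u) with rfl | hv'
          · simp [Γ.adj_comm]
          · rw [Equiv.swap_apply_left, Equiv.swap_apply_of_ne_of_ne hv hv', hself' v hv hv']
      · rcases eq_or_ne u (z • x) with rfl | hu'
        · rcases eq_or_ne v x with rfl | hv
          · simp [Γ.adj_comm]
          · rcases eq_or_ne v (z • x) with rfl | hv'
            · simp
            · rw [Equiv.swap_apply_right, Equiv.swap_apply_of_ne_of_ne hv hv', hself' v hv hv']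
        · rw [Equiv.swap_apply_of_ne_of_ne hu hu']
          rcases eq_or_ne v x with rfl | hv
          · rw [Equiv.swap_apply_left, hself u hu hu']
          · rcases eq_or_ne v (z • x) with rfl | hv'
            · rw [Equiv.swap_apply_right, hself u hu hu']
            · rw [Equiv.swap_apply_of_ne_of_ne hv hv']
    have hswap := h.smul_eq_of_involutive (Equiv.swap_apply_self _ _)
      ⟨x, by rwa [Equiv.swap_apply_left]⟩ hadj
    have h1 : ((a 1, 1) : QuaternionGroup 2 × Cyc 3) • x ≠ x := fun he =>
      absurd (hfree x hx (he.trans (one_smul _ x).symm)) (by decide)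
    have h2 : ((a 1, 1) : QuaternionGroup 2 × Cyc 3) • x ≠ z • x := fun he =>
      absurd (hfree x hx he) (by decide)
    have h3 := hswap (((a 1, 1) : QuaternionGroup 2 × Cyc 3) • x)
    rw [Equiv.swap_apply_of_ne_of_ne h1 h2] at h3
    exact hx (hmove _ _ h3)
  · push Not at horb
    obtain ⟨y, hy, hyx⟩ := horb
    have hccc : ∀ v : V, c • c • c • v = v := fun v => by
      rw [smul_smul, smul_smul, show c * c * c = 1 from by decide, one_smul]
    let ι : (QuaternionGroup 2 ⊕ QuaternionGroup 2) ⊕ {v : V // c • v ≠ v} → V :=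
      Sum.elim (Sum.elim (fun q => ((q, 1) : QuaternionGroup 2 × Cyc 3) • x)
        (fun q => ((q, 1) : QuaternionGroup 2 × Cyc 3) • y)) Subtype.val
    have hι : Function.Injective ι := by
      refine ((hfree x hx).sumElim (hfree y hy) fun p q hpq => ?_).sumElim
        Subtype.val_injective ?_
      · apply hyx (q⁻¹ * p)
        rw [show ((q⁻¹ * p, 1) : QuaternionGroup 2 × Cyc 3) = (q, 1)⁻¹ * (p, 1) by simp, mul_smul,
          hpq, inv_smul_smul]
      · rintro (q | q) ⟨v, hv⟩ rfl
        · exact hv (hzc _ fun he => hx (hmove _ _ he))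
        · exact hv (hzc _ fun he => hy (hmove _ _ he))
    have hle := Fintype.card_le_of_injective ι hι
    rw [Fintype.card_sum, Fintype.card_sum,
      show Fintype.card (QuaternionGroup 2) = 8 by decide +kernel] at hle
    obtain ⟨τ, ⟨t, ht⟩, hττ, hτc, hτ⟩ := exists_involution_of_card_moved_le (Γ := Γ) (c • ·) hccc
      (h.adj_smul c) (by
        by_contra! hall
        exact hc1 (h.eq_one c hall)) (by omega)
    have hzt := h.smul_eq_of_involutive hττ ⟨t, ht⟩ hτ t
    rcases hor t with h1 | h1
    · exact ht (hzt.symm.trans h1)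
    · exact ht (hτc t h1)

end IsFullAction

end

/-- A graph whose automorphism group is `Q₈ × C₃` has at least 25 vertices. -/
lemma le_card_of_mulEquiv {n : ℕ} {Γ : SimpleGraph (Fin n)}
    (e : (Γ ≃g Γ) ≃* QuaternionGroup 2 × Cyc 3) : 25 ≤ n := by
  let _ : MulAction (QuaternionGroup 2 × Cyc 3) (Fin n) :=
    { smul g x := e.symm g x
      one_smul x := by
        change e.symm 1 x = x
        rw [map_one, RelIso.one_apply]
      mul_smul g k x := by
        change e.symm (g * k) x = e.symm g (e.symm k x)
        rw [map_mul, RelIso.mul_apply] }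
  have h : IsFullAction Γ :=
    { adj_smul g x y := (e.symm g).map_rel_iff
      eq_one g hg := e.symm.map_eq_one_iff.1 (RelIso.ext hg)
      exists_smul_eq σ hσ := by
        refine ⟨e ⟨σ, hσ _ _⟩, fun x => ?_⟩
        change e.symm (e _) x = σ x
        rw [e.symm_apply_apply]
        rfl }
  exact Fintype.card_fin n ▸ h.card_gt

/-- Proposition: the group `Q₈ × C₃` of order 24 satisfies
`α(Q₈ × C₃) = 25`. Here `Q₈ = QuaternionGroup 2`. -/
theorem alpha_Q8_times_C3 : graphAlpha (QuaternionGroup 2 × Cyc 3) = 25 :=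
  le_antisymm (Nat.sInf_le exists_graph_fin_25)
    (le_csInf ⟨25, exists_graph_fin_25⟩ fun _ ⟨_, ⟨e⟩⟩ => le_card_of_mulEquiv e)
end

section
/- The group G′₁₆ = ⟨a, b ∣ a⁸ = b² = 1, b a b⁻¹ = a⁵⟩ of order 16 satisfies α(G′₁₆) = 18. -/
/-- Relators of `G′₁₆ = ⟨a, b ∣ a⁸ = b² = 1, b a b⁻¹ = a⁵⟩`. -/
def G16'Rels : Set (FreeGroup (Fin 2)) :=
  {(FreeGroup.of 0) ^ 8, (FreeGroup.of 1) ^ 2,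
    FreeGroup.of 1 * FreeGroup.of 0 * (FreeGroup.of 1)⁻¹ * ((FreeGroup.of 0) ^ 5)⁻¹}

/-- `G′₁₆ = ⟨a, b ∣ a⁸ = b² = 1, b a b⁻¹ = a⁵⟩ ≅ C₈ ⋊ C₂`. -/
abbrev G16' := PresentedGroup G16'Rels

open Equiv

section NormalForm

variable {G : Type*} [Group G] {a b : G}

theorem pow_fin_val_add {n : ℕ} (ha : a ^ n = 1) (i j : Fin n) :
    a ^ (i + j).val = a ^ i.val * a ^ j.val := by
  rw [Fin.val_add, ← pow_add, pow_eq_pow_mod (i.val + j.val) ha]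

theorem mul_pow_of_conj {m : ℕ} (hab : b * a = a ^ m * b) (k : ℕ) :
    b * a ^ k = a ^ (m * k) * b := by
  have h : SemiconjBy b a (a ^ m) := hab
  rw [pow_mul]
  exact (h.pow_right k).eq

theorem exists_eq_pow_mul_pow_of_closure_eq_top (ha : a ^ 8 = 1) (hb : b ^ 2 = 1)
    (hab : b * a = a ^ 5 * b) (hgen : Subgroup.closure {a, b} = ⊤) (g : G) :
    ∃ (i : Fin 8) (j : Fin 2), g = a ^ i.val * b ^ j.val := by
  suffices h : ∃ i j : ℕ, g = a ^ i * b ^ j by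
    obtain ⟨i, j, rfl⟩ := h
    refine ⟨⟨i % 8, Nat.mod_lt _ (by norm_num)⟩, ⟨j % 2, Nat.mod_lt _ (by norm_num)⟩, ?_⟩
    rw [pow_eq_pow_mod i ha, pow_eq_pow_mod j hb]
  have hg : g ∈ Subgroup.closure {a, b} := hgen ▸ Subgroup.mem_top g
  have hainv : a⁻¹ = a ^ 7 := inv_eq_of_mul_eq_one_right (by rw [← pow_succ', ha])
  have hbinv : b⁻¹ = b := inv_eq_of_mul_eq_one_right (by rw [← sq, hb])
  have hbmul : ∀ i j : ℕ, b * (a ^ i * b ^ j) = a ^ (5 * i) * b ^ (j + 1) := fun i j => by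
    rw [← mul_assoc, mul_pow_of_conj hab, mul_assoc, ← pow_succ']
  induction hg using Subgroup.closure_induction_left with
  | one => exact ⟨0, 0, by simp⟩
  | mul_left x hx y _ ih =>
    obtain ⟨i, j, rfl⟩ := ih
    rcases hx with rfl | rfl
    · exact ⟨i + 1, j, by rw [← mul_assoc, ← pow_succ']⟩
    · exact ⟨_, _, hbmul i j⟩
  | inv_mul_cancel x hx y _ ih =>
    obtain ⟨i, j, rfl⟩ := ih
    rcases hx with rfl | rfl
    · exact ⟨7 + i, j, by rw [hainv, ← mul_assoc, ← pow_add]⟩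
    · rw [hbinv]
      exact ⟨_, _, hbmul i j⟩

end NormalForm

namespace ModularSixteen

/-- The generator `a`. -/
def a : G16' := PresentedGroup.of 0

/-- The generator `b`. -/
def b : G16' := PresentedGroup.of 1

theorem a_pow_eight : a ^ 8 = 1 :=
  PresentedGroup.one_of_mem (rels := G16'Rels) (Or.inl rfl)

theorem b_sq : b ^ 2 = 1 :=
  PresentedGroup.one_of_mem (rels := G16'Rels) (Or.inr (Or.inl rfl))

theorem b_mul_a : b * a = a ^ 5 * b := by
  have h : b * a * b⁻¹ * (a ^ 5)⁻¹ = 1 :=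
    PresentedGroup.one_of_mem (rels := G16'Rels) (Or.inr (Or.inr rfl))
  rw [mul_inv_eq_one, mul_inv_eq_iff_eq_mul] at h
  exact h

theorem closure_eq_top : Subgroup.closure {a, b} = (⊤ : Subgroup G16') := by
  rw [← PresentedGroup.closure_range_of G16'Rels]
  congr 1
  ext x
  simp [Fin.exists_fin_two, a, b, eq_comm]

theorem exists_eq_pow_mul_pow (g : G16') :
    ∃ (i : Fin 8) (j : Fin 2), g = a ^ i.val * b ^ j.val :=
  exists_eq_pow_mul_pow_of_closure_eq_top a_pow_eight b_sq b_mul_a closure_eq_top g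

variable {H : Type*} [Group H] {x y : H}

theorem lift_rels (hx : x ^ 8 = 1) (hy : y ^ 2 = 1) (hxy : y * x = x ^ 5 * y) :
    ∀ r ∈ G16'Rels, FreeGroup.lift ![x, y] r = 1 := by
  rintro r (rfl | rfl | rfl)
  · simpa using hx
  · simpa using hy
  · simp [hxy]

/-- The homomorphism out of `G16'` given by images of the generators satisfying the relations. -/
def lift (hx : x ^ 8 = 1) (hy : y ^ 2 = 1) (hxy : y * x = x ^ 5 * y) : G16' →* H :=
  PresentedGroup.toGroup (lift_rels hx hy hxy)

theorem lift_a (hx : x ^ 8 = 1) (hy : y ^ 2 = 1) (hxy : y * x = x ^ 5 * y) :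
    lift hx hy hxy a = x :=
  PresentedGroup.toGroup.of (lift_rels hx hy hxy)

theorem lift_b (hx : x ^ 8 = 1) (hy : y ^ 2 = 1) (hxy : y * x = x ^ 5 * y) :
    lift hx hy hxy b = y :=
  PresentedGroup.toGroup.of (lift_rels hx hy hxy)

end ModularSixteen

/-! ### A graph on 18 vertices -/

section PartialAutomorphisms

variable {n : ℕ}

/-- The graphs of all injective maps on the vertices in a list that preserve `adj`. -/
def partialAuts (adj : Fin n → Fin n → Bool) : List (Fin n) → List (List (Fin n × Fin n))
  | [] => [[]]
  | v :: vs => (partialAuts adj vs).flatMap fun l =>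
      ((List.finRange n).filter fun w =>
        l.all fun q => (v == q.1) == (w == q.2) && adj v q.1 == adj w q.2).map fun w => (v, w) :: l

theorem map_mem_partialAuts {adj : Fin n → Fin n → Bool} {f : Fin n → Fin n}
    (hf : Function.Injective f) (hadj : ∀ x y, adj (f x) (f y) = adj x y) (l : List (Fin n)) :
    l.map (fun v => (v, f v)) ∈ partialAuts adj l := by
  induction l with
  | nil => simp [partialAuts]
  | cons v vs ih =>
    simp only [partialAuts, List.map_cons, List.mem_flatMap, List.mem_map, List.mem_filter]
    refine ⟨_, ih, f v, ⟨List.mem_finRange _, ?_⟩, rfl⟩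
    simp [hadj, hf.eq_iff]

end PartialAutomorphisms

namespace ModularSixteen

/-- Half of the adjacency relation of `graph`: the vertices `i` and `8 + i` with `i < 8` stand for
`aⁱ` and `aⁱb`, and `16`, `17` for the cosets of `⟨a⟩`. -/
def arc (x y : ℕ) : Bool :=
  if x < 8 then y == (x + 1) % 8 || y == 8 + x || y == 8 + (x + 1) % 8 || y == 8 + (x + 3) % 8 ||
    y == 16
  else x < 16 && (y == 8 + (x + 3) % 8 || y == 17)

/-- The adjacency relation of `graph`. -/
def adj (x y : Fin 18) : Bool := arc x y || arc y x

/-- A graph on 18 vertices with automorphism group `G16'`. -/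
def graph : SimpleGraph (Fin 18) where
  Adj x y := adj x y
  symm := ⟨fun x y h => by rwa [adj, Bool.or_comm]⟩
  loopless := ⟨by decide⟩

/-- The left multiplication by `a` on the vertices. -/
def rotateFun (x : Fin 18) : Fin 18 :=
  if x.val < 8 then Fin.ofNat 18 ((x + 1) % 8)
  else if x.val < 16 then Fin.ofNat 18 (8 + (x + 1) % 8) else x

/-- The left multiplication by `b` on the vertices. -/
def flipFun (x : Fin 18) : Fin 18 :=
  if x.val < 8 then Fin.ofNat 18 (8 + 5 * x % 8)
  else if x.val < 16 then Fin.ofNat 18 (5 * x % 8) else Fin.ofNat 18 (33 - x)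

/-- The automorphism of `graph` given by left multiplication by `a`. -/
def rotate : graph ≃g graph where
  toFun := rotateFun
  invFun := rotateFun^[7]
  left_inv := by unfold Function.LeftInverse; decide +kernel
  right_inv := by unfold Function.RightInverse Function.LeftInverse; decide +kernel
  map_rel_iff' := by
    change ∀ {x y}, adj (rotateFun x) (rotateFun y) = true ↔ adj x y = true
    decide +kernel

/-- The automorphism of `graph` given by left multiplication by `b`. -/
def flip : graph ≃g graph where
  toFun := flipFun
  invFun := flipFun
  left_inv := by unfold Function.LeftInverse; decide +kernel
  right_inv := by unfold Function.RightInverse Function.LeftInverse; decide +kernel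
  map_rel_iff' := by
    change ∀ {x y}, adj (flipFun x) (flipFun y) = true ↔ adj x y = true
    decide +kernel

theorem rotate_pow_apply (k : ℕ) (x : Fin 18) : (rotate ^ k) x = rotateFun^[k] x := by
  induction k generalizing x with
  | zero => rfl
  | succ k ih => rw [pow_succ, Function.iterate_succ_apply, ← ih]; rfl

theorem flip_pow_apply (k : ℕ) (x : Fin 18) : (flip ^ k) x = flipFun^[k] x := by
  induction k generalizing x with
  | zero => rfl
  | succ k ih => rw [pow_succ, Function.iterate_succ_apply, ← ih]; rfl

theorem rotate_pow_mul_flip_pow_apply (i j : ℕ) (x : Fin 18) :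
    (rotate ^ i * flip ^ j) x = rotateFun^[i] (flipFun^[j] x) := by
  rw [← flip_pow_apply, ← rotate_pow_apply]
  rfl

theorem rotate_pow_eight : rotate ^ 8 = 1 := by
  ext x
  rw [rotate_pow_apply]
  revert x
  decide +kernel

theorem flip_sq : flip ^ 2 = 1 := by
  ext x
  rw [flip_pow_apply]
  revert x
  decide +kernel

theorem flip_mul_rotate : flip * rotate = rotate ^ 5 * flip := by
  ext x
  rw [RelIso.mul_apply, RelIso.mul_apply, rotate_pow_apply]
  change (flipFun (rotateFun x)).val = (rotateFun^[5] (flipFun x)).val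
  revert x
  decide +kernel

/-- An ordering of the vertices of `graph` with few partial automorphisms. -/
def vertexOrder : List (Fin 18) :=
  [1, 12, 9, 14, 11, 0, 8, 7, 6, 15, 10, 17, 13, 5, 4, 16, 3, 2]

theorem mem_vertexOrder : ∀ x, x ∈ vertexOrder := by decide

theorem partialAuts_graph : ∀ l ∈ partialAuts adj vertexOrder, ∃ (i : Fin 8) (j : Fin 2),
    l.all fun q => q.2 == rotateFun^[i.val] (flipFun^[j.val] q.1) := by
  decide +kernel

theorem exists_eq_rotate_pow_mul_flip_pow (f : graph ≃g graph) :
    ∃ (i : Fin 8) (j : Fin 2), f = rotate ^ i.val * flip ^ j.val := by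
  have hf : ∀ x y, adj (f x) (f y) = adj x y := fun x y =>
    Bool.eq_iff_iff.2 (f.map_rel_iff (a := x) (b := y))
  obtain ⟨i, j, hij⟩ := partialAuts_graph _ (map_mem_partialAuts f.injective hf vertexOrder)
  refine ⟨i, j, RelIso.ext fun x => ?_⟩
  rw [List.all_map, List.all_eq_true] at hij
  rw [rotate_pow_mul_flip_pow_apply]
  simpa using hij x (mem_vertexOrder x)

theorem rotate_pow_mul_flip_pow_eq_one (i : Fin 8) (j : Fin 2)
    (h : rotate ^ i.val * flip ^ j.val = 1) : i = 0 ∧ j = 0 := by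
  have h0 : rotateFun^[i.val] (flipFun^[j.val] 0) = 0 := by
    rw [← rotate_pow_mul_flip_pow_apply, h]; rfl
  revert i j
  decide +kernel

/-- The action of `G16'` on `graph`. -/
def toAut : G16' →* (graph ≃g graph) := lift rotate_pow_eight flip_sq flip_mul_rotate

theorem toAut_pow_mul_pow (i j : ℕ) : toAut (a ^ i * b ^ j) = rotate ^ i * flip ^ j := by
  simp [toAut, lift_a, lift_b]

theorem toAut_bijective : Function.Bijective toAut := by
  constructor
  · rw [injective_iff_map_eq_one]
    intro g hg
    obtain ⟨i, j, rfl⟩ := exists_eq_pow_mul_pow g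
    rw [toAut_pow_mul_pow] at hg
    obtain ⟨rfl, rfl⟩ := rotate_pow_mul_flip_pow_eq_one i j hg
    simp
  · intro f
    obtain ⟨i, j, rfl⟩ := exists_eq_rotate_pow_mul_flip_pow f
    exact ⟨_, toAut_pow_mul_pow i j⟩

theorem a_pow_four_ne_one : a ^ 4 ≠ 1 := by
  intro h
  have h' : rotate ^ (4 : Fin 8).val * flip ^ (0 : Fin 2).val = 1 := by
    rw [← toAut_pow_mul_pow]
    simp [h]
  exact absurd (rotate_pow_mul_flip_pow_eq_one 4 0 h').1 (by decide)

end ModularSixteen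

/-! ### The lower bound -/

section LowerBound

variable {V : Type*}

theorem adj_viaEmbedding_iff {Γ : SimpleGraph V} {ι : Type*} (p : ι ↪ V) (σ : Perm ι)
    (hin : ∀ x y, Γ.Adj (p (σ x)) (p (σ y)) ↔ Γ.Adj (p x) (p y))
    (hout : ∀ w ∉ Set.range p, ∀ x, Γ.Adj w (p (σ x)) ↔ Γ.Adj w (p x)) (v w : V) :
    Γ.Adj (σ.viaEmbedding p v) (σ.viaEmbedding p w) ↔ Γ.Adj v w := by
  by_cases hv : v ∈ Set.range p <;> by_cases hw : w ∈ Set.range p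
  · obtain ⟨x, rfl⟩ := hv
    obtain ⟨y, rfl⟩ := hw
    simpa only [Perm.viaEmbedding_apply] using hin x y
  · obtain ⟨x, rfl⟩ := hv
    rw [Perm.viaEmbedding_apply, Perm.viaEmbedding_apply_of_notMem _ _ _ hw, Γ.adj_comm,
      hout w hw, Γ.adj_comm]
  · obtain ⟨y, rfl⟩ := hw
    rw [Perm.viaEmbedding_apply, Perm.viaEmbedding_apply_of_notMem _ _ _ hv, hout v hv]
  · rw [Perm.viaEmbedding_apply_of_notMem _ _ _ hv, Perm.viaEmbedding_apply_of_notMem _ _ _ hw]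

/-- The permutations `a` and `b` satisfy the relations of `G16'`, and every automorphism of `Γ`
is of the form `aⁱbʲ`. -/
structure IsModularPair (Γ : SimpleGraph V) (a b : Perm V) : Prop where
  adj_a : ∀ x y, Γ.Adj (a x) (a y) ↔ Γ.Adj x y
  adj_b : ∀ x y, Γ.Adj (b x) (b y) ↔ Γ.Adj x y
  a_pow_eight : a ^ 8 = 1
  b_sq : b ^ 2 = 1
  b_mul_a : b * a = a ^ 5 * b
  a_pow_four_ne_one : a ^ 4 ≠ 1
  exists_eq : ∀ σ : Perm V, (∀ x y, Γ.Adj (σ x) (σ y) ↔ Γ.Adj x y) →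
    ∃ (i : Fin 8) (j : Fin 2), σ = a ^ i.val * b ^ j.val

namespace IsModularPair

variable {Γ : SimpleGraph V} {a b : Perm V} (h : IsModularPair Γ a b)
include h

theorem b_b (x : V) : b (b x) = x := by
  rw [← Perm.mul_apply, ← sq, h.b_sq, Perm.one_apply]

theorem b_pow (k : ℕ) (x : V) : b ((a ^ k) x) = (a ^ (5 * k)) (b x) := by
  rw [← Perm.mul_apply, mul_pow_of_conj h.b_mul_a, Perm.mul_apply]

theorem adj_pow (k : ℕ) (x y : V) : Γ.Adj ((a ^ k) x) ((a ^ k) y) ↔ Γ.Adj x y := by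
  induction k with
  | zero => rfl
  | succ k ih => rw [pow_succ', Perm.mul_apply, Perm.mul_apply, h.adj_a, ih]

theorem pow_add_apply (i j : Fin 8) (x : V) :
    (a ^ (i + j).val) x = (a ^ i.val) ((a ^ j.val) x) := by
  rw [pow_fin_val_add h.a_pow_eight, Perm.mul_apply]

theorem b_pow_val (k : Fin 8) (x : V) : b ((a ^ k.val) x) = (a ^ (5 * k).val) (b x) := by
  rw [h.b_pow, Fin.val_mul, ← pow_eq_pow_mod _ h.a_pow_eight]
  rfl

/-- An orbit of `a` that is not pointwise fixed by `a ^ 4` is regular. -/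
theorem pow_val_injective {v : V} (hv : (a ^ 4) v ≠ v) :
    Function.Injective fun k : Fin 8 => (a ^ k.val) v := by
  suffices key : ∀ k : Fin 8, (a ^ k.val) v = v → k = 0 by
    intro i j hij
    have hij' : (a ^ i.val) v = (a ^ j.val) v := hij
    refine sub_eq_zero.1 (key _ ?_)
    apply (a ^ j.val).injective
    rw [← h.pow_add_apply, add_sub_cancel, hij']
  intro k hk
  have hmul : ∀ m : ℕ, (a ^ (k.val * m)) v = v := fun m => by
    rw [pow_mul]
    exact Perm.pow_apply_eq_self_of_apply_eq_self hk m
  have hfour : ∀ m : ℕ, k.val * m % 8 ≠ 4 := fun m hm => hv <| by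
    rw [← hm, ← pow_eq_pow_mod _ h.a_pow_eight, hmul]
  have := hfour 1
  have := hfour 2
  have := hfour 4
  omega

omit h in
theorem pow_four_pow_ne {x : V} (hx : (a ^ 4) x ≠ x) (k : ℕ) :
    (a ^ 4) ((a ^ k) x) ≠ (a ^ k) x := by
  rwa [← Perm.mul_apply, ← pow_add, add_comm, pow_add, Perm.mul_apply, Ne,
    (a ^ k).injective.eq_iff]

/-- If `b` preserves the orbit of `v` under `a`, then it fixes a point of this orbit. -/
theorem exists_fixed {v : V} (hv : (a ^ 4) v ≠ v) {k : Fin 8} (hk : b v = (a ^ k.val) v) :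
    ∃ m : ℕ, b ((a ^ m) v) = (a ^ m) v := by
  have h6 : (a ^ (5 * k + k).val) v = (a ^ (0 : Fin 8).val) v := by
    rw [h.pow_add_apply, ← hk, Fin.val_zero, pow_zero, Perm.one_apply]
    conv_rhs => rw [← h.b_b v, hk, h.b_pow_val]
  have hdiv : ∀ k : Fin 8, 5 * k + k = 0 → k = 0 ∨ k = 4 := by decide
  rcases hdiv k (h.pow_val_injective hv h6) with rfl | rfl
  · exact ⟨0, hk⟩
  · refine ⟨1, ?_⟩
    have := h.b_pow_val 1 v
    rw [hk, ← h.pow_add_apply] at this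
    exact this

/-- If only one orbit of `a` is moved by `a ^ 4` and `b` fixes a point `v` of it, then exchanging
`v` and `a ^ 4 • v` is an automorphism that is not of the form `aⁱbʲ`. -/
theorem exists_second_orbit {v : V} (hv : (a ^ 4) v ≠ v) (hb : b v = v) :
    ∃ w, (a ^ 4) w ≠ w ∧ ∀ k : Fin 8, w ≠ (a ^ k.val) v := by
  classical
  by_contra! hw
  have hinj := h.pow_val_injective hv
  have hpp : ∀ i j : ℕ, (a ^ i) ((a ^ j) v) = (a ^ ((i + j) % 8)) v := fun i j => by
    rw [← Perm.mul_apply, ← pow_add, ← pow_eq_pow_mod _ h.a_pow_eight]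
  have htwin : ∀ w, w ≠ v → w ≠ (a ^ 4) v → (Γ.Adj v w ↔ Γ.Adj ((a ^ 4) v) w) := by
    intro w h1 h2
    by_cases hw4 : (a ^ 4) w = w
    · rw [← h.adj_pow 4 v w, hw4]
    · obtain ⟨k, rfl⟩ := hw w hw4
      have hodd : ∀ k : ℕ, k < 4 →
          (Γ.Adj v ((a ^ (2 * k + 1)) v) ↔ Γ.Adj ((a ^ 4) v) ((a ^ (2 * k + 1)) v)) := by
        intro k _
        rw [← h.adj_b, hb, h.b_pow, hb, ← h.adj_pow 4, hpp,
          show (4 + 5 * (2 * k + 1)) % 8 = (2 * k + 1) % 8 by omega,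
          ← pow_eq_pow_mod _ h.a_pow_eight]
      have h26 : Γ.Adj v ((a ^ 2) v) ↔ Γ.Adj ((a ^ 4) v) ((a ^ 2) v) := by
        rw [← h.adj_pow 2, hpp, Γ.adj_comm]
      have h62 : Γ.Adj v ((a ^ 6) v) ↔ Γ.Adj ((a ^ 4) v) ((a ^ 6) v) := by
        have h1 : Γ.Adj v ((a ^ 6) v) ↔ Γ.Adj v ((a ^ 2) v) := by
          rw [← h.adj_pow 2, hpp, Γ.adj_comm]
          rfl
        have h2 : Γ.Adj ((a ^ 4) v) ((a ^ 6) v) ↔ Γ.Adj v ((a ^ 2) v) := by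
          rw [← h.adj_pow 4 v, hpp]
        rw [h1, h2]
      fin_cases k
      · exact absurd rfl h1
      · exact hodd 0 (by norm_num)
      · exact h26
      · exact hodd 1 (by norm_num)
      · exact absurd rfl h2
      · exact hodd 2 (by norm_num)
      · exact h62
      · exact hodd 3 (by norm_num)
  have hswap : ∀ x y, Γ.Adj (swap v ((a ^ 4) v) x) (swap v ((a ^ 4) v) y) ↔ Γ.Adj x y := by
    intro x y
    rw [swap_apply_def, swap_apply_def]
    have := htwin x
    have := htwin y
    split_ifs <;> subst_vars <;> grind [SimpleGraph.adj_comm, SimpleGraph.irrefl]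
  obtain ⟨i, j, hij⟩ := h.exists_eq _ hswap
  have hact : ∀ m : Fin 8,
      swap v ((a ^ 4) v) ((a ^ m.val) v) = (a ^ (i + if j = 0 then m else 5 * m).val) v := by
    intro m
    rw [hij, h.pow_add_apply, Perm.mul_apply]
    fin_cases j
    · simp
    · simp [h.b_pow_val, hb]
  have hfix : ∀ m : Fin 8, m ≠ 0 → m ≠ 4 → i + (if j = 0 then m else 5 * m) = m := by
    intro m h0 h4
    refine hinj ?_
    change (a ^ (i + if j = 0 then m else 5 * m).val) v = (a ^ m.val) v
    rw [← hact, swap_apply_of_ne_of_ne]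
    · exact fun h' => h0 (hinj h')
    · exact fun h' => h4 (hinj h')
  have hzero : i + (if j = 0 then 0 else 5 * 0) = 4 := by
    refine hinj ?_
    change (a ^ (i + if j = 0 then 0 else 5 * 0).val) v = (a ^ 4) v
    rw [← hact]
    exact swap_apply_left v _
  clear hact hij
  revert i j
  decide

/-- The two orbits of `u 0` and `u 1` under `a`. -/
def orbits (a : Perm V) (u : Fin 2 → V) (x : Fin 8 × Fin 2) : V := (a ^ x.1.val) (u x.2)

omit h in
theorem orbits_zero (u : Fin 2 → V) (c : Fin 2) : orbits a u (0, c) = u c := rfl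

theorem pow_orbits (u : Fin 2 → V) (k : Fin 8) (x : Fin 8 × Fin 2) :
    (a ^ k.val) (orbits a u x) = orbits a u (k + x.1, x.2) :=
  (h.pow_add_apply _ _ _).symm

theorem adj_orbits (u : Fin 2 → V) (x y : Fin 8 × Fin 2) :
    Γ.Adj (orbits a u x) (orbits a u y) ↔ Γ.Adj (u x.2) (orbits a u (y.1 - x.1, y.2)) := by
  rw [← orbits_zero (a := a) u x.2, ← h.adj_pow x.1.val (orbits a u (0, x.2)), h.pow_orbits,
    h.pow_orbits, add_zero, add_sub_cancel]

theorem orbits_injective {u : Fin 2 → V} (hu : ∀ c, (a ^ 4) (u c) ≠ u c)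
    (hne : ∀ k : Fin 8, u 1 ≠ (a ^ k.val) (u 0)) : Function.Injective (orbits a u) := by
  have hne' : ∀ i j : Fin 8, orbits a u (i, 0) ≠ orbits a u (j, 1) := fun i j hij => by
    apply hne (i - j)
    apply (a ^ j.val).injective
    rw [← h.pow_add_apply, add_sub_cancel]
    exact hij.symm
  rintro ⟨i, c⟩ ⟨j, d⟩ hij
  by_cases hcd : c = d
  · subst hcd
    exact congrArg (·, c) (h.pow_val_injective (hu c) hij)
  · obtain ⟨rfl, rfl⟩ | ⟨rfl, rfl⟩ : c = 0 ∧ d = 1 ∨ c = 1 ∧ d = 0 := by omega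
    · exact absurd hij (hne' i j)
    · exact absurd hij.symm (hne' j i)

end IsModularPair

theorem apply_eq_self_of_card_lt [Fintype V] {ι : Type*} [Fintype ι] (p : ι ↪ V)
    (hcard : Fintype.card V < Fintype.card ι + 2) {f : Perm V}
    (hf : ∀ x, f⁻¹ (p x) ∈ Set.range p) {w : V} (hw : w ∉ Set.range p) : f w = w := by
  classical
  by_contra hne
  have hfw : f w ∉ Set.range p := by
    rintro ⟨x, hx⟩
    apply hw
    simpa [hx] using hf x
  have hcard' : (insert (f w) (insert w (Finset.univ.map p))).card = Fintype.card ι + 2 := by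
    rw [Finset.card_insert_of_notMem, Finset.card_insert_of_notMem, Finset.card_map,
      Finset.card_univ]
    · simpa using hw
    · simpa [hne] using hfw
  exact absurd (hcard' ▸ Finset.card_le_univ _) (by omega)

namespace IsModularPair

variable {Γ : SimpleGraph V} {a b : Perm V} (h : IsModularPair Γ a b)
include h

/-- A permutation of two regular orbits of `a` that extends by the identity to an automorphism of a
graph on at most 17 vertices is given by some `aⁱbʲ`. -/
theorem exists_eq_of_orbits [Fintype V] (hcard : Fintype.card V < 18) {u : Fin 2 → V}
    (hinj : Function.Injective (orbits a u)) {β σ : Fin 8 × Fin 2 → Fin 8 × Fin 2}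
    (hβ : ∀ x, b (orbits a u x) = orbits a u (β x)) (hσ : Function.Involutive σ)
    (hin : ∀ x y, Γ.Adj (orbits a u (σ x)) (orbits a u (σ y)) ↔
      Γ.Adj (orbits a u x) (orbits a u y))
    (hout : ∀ w, b w = w → ∀ x, Γ.Adj w (u (σ x).2) ↔ Γ.Adj w (u x.2)) :
    ∃ (i : Fin 8) (j : Fin 2), ∀ x, σ x = (i + (β^[j.val] x).1, (β^[j.val] x).2) := by
  let p : Fin 8 × Fin 2 ↪ V := ⟨orbits a u, hinj⟩
  have hcard' : Fintype.card V < Fintype.card (Fin 8 × Fin 2) + 2 := by simpa using hcard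
  have ha : ∀ w ∉ Set.range p, a w = w := fun w => apply_eq_self_of_card_lt p hcard' fun x => by
    have : a⁻¹ = a ^ (7 : Fin 8).val :=
      inv_eq_of_mul_eq_one_right (by rw [← pow_succ', ← h.a_pow_eight]; rfl)
    exact ⟨_, by rw [this]; exact (h.pow_orbits u 7 x).symm⟩
  have hb : ∀ w ∉ Set.range p, b w = w := fun w => apply_eq_self_of_card_lt p hcard' fun x => by
    have : b⁻¹ = b := inv_eq_of_mul_eq_one_right (by rw [← sq, h.b_sq])
    exact ⟨_, by rw [this]; exact (hβ x).symm⟩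
  have hfix : ∀ w ∉ Set.range p, ∀ x, Γ.Adj w (p x) ↔ Γ.Adj w (u x.2) := fun w hw x => by
    rw [← h.adj_pow x.1.val w (u x.2),
      Perm.pow_apply_eq_self_of_apply_eq_self (ha w hw)]
    rfl
  obtain ⟨i, j, hij⟩ := h.exists_eq ((hσ.toPerm σ).viaEmbedding p) <|
    adj_viaEmbedding_iff p _ hin fun w hw x => by
      rw [hfix w hw, hfix w hw]
      exact hout w (hb w hw) x
  refine ⟨i, j, fun x => hinj ?_⟩
  have hbpow : ∀ k : ℕ, (b ^ k) (orbits a u x) = orbits a u (β^[k] x) := fun k => by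
    induction k with
    | zero => rfl
    | succ k ih => rw [pow_succ', Perm.mul_apply, ih, hβ, Function.iterate_succ_apply']
  have hx := Perm.viaEmbedding_apply (hσ.toPerm σ) p x
  rw [hij, Perm.mul_apply] at hx
  rw [← h.pow_orbits, ← hbpow]
  exact hx.symm

theorem adj_orbits_swap (u : Fin 2 → V) (c d : Fin 2) (k : Fin 8) :
    Γ.Adj (u c) (orbits a u (k, d)) ↔ Γ.Adj (u d) (orbits a u (-k, c)) := by
  rw [Γ.adj_comm, ← orbits_zero (a := a) u c, h.adj_orbits, zero_sub]

/-- The relation between the orbits of `u c` and `u d` under `a`, recorded at `(c, d, k)` as the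
adjacency of `u c` and `aᵏ • u d`. -/
def orbitRel (Γ : SimpleGraph V) (a : Perm V) (u : Fin 2 → V) (t : Fin 2 × Fin 2 × Fin 8) : Prop :=
  Γ.Adj (u t.1) (orbits a u (t.2.2, t.2.1))

/-- The position of the pair `(x, y)` in `orbitRel`. -/
def offset (x y : Fin 8 × Fin 2) : Fin 2 × Fin 2 × Fin 8 := (x.2, y.2, y.1 - x.1)

/-- `σ` is an involution of two orbits that is not given by any `aⁱbʲ`, where `β` is the action of
`b`, and it preserves adjacency as soon as `orbitRel` agrees on the pairs in `E`. Here `nf` is a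
normal form for the arguments of `orbitRel`. -/
def IsTwist (β : Fin 8 × Fin 2 → Fin 8 × Fin 2)
    (nf : Fin 2 × Fin 2 × Fin 8 → Fin 2 × Fin 2 × Fin 8) (σ : Fin 8 × Fin 2 → Fin 8 × Fin 2)
    (E : List ((Fin 2 × Fin 2 × Fin 8) × (Fin 2 × Fin 2 × Fin 8))) : Prop :=
  (∀ x, σ (σ x) = x) ∧
  (∀ x y, nf (offset (σ x) (σ y)) = nf (offset x y) ∨
    (nf (offset (σ x) (σ y)), nf (offset x y)) ∈ E ∨
    (nf (offset x y), nf (offset (σ x) (σ y))) ∈ E) ∧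
  ¬ ∃ (i : Fin 8) (j : Fin 2), ∀ x, σ x = (i + (β^[j.val] x).1, (β^[j.val] x).2)

set_option synthInstance.maxSize 1000 in
instance (β : Fin 8 × Fin 2 → Fin 8 × Fin 2)
    (nf : Fin 2 × Fin 2 × Fin 8 → Fin 2 × Fin 2 × Fin 8) (σ : Fin 8 × Fin 2 → Fin 8 × Fin 2)
    (E : List ((Fin 2 × Fin 2 × Fin 8) × (Fin 2 × Fin 2 × Fin 8))) :
    Decidable (IsTwist β nf σ E) := by
  unfold IsTwist
  infer_instance

/-- The normal form for two orbits whose base points are fixed by `b`. -/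
def fixedNF : Fin 2 × Fin 2 × Fin 8 → Fin 2 × Fin 2 × Fin 8
  | (0, 1, k) => (0, 1, if k.val % 2 = 1 then min k (5 * k) else k)
  | (1, 0, k) => (0, 1, if k.val % 2 = 1 then min (-k) (5 * -k) else -k)
  | (c, d, k) => (c, d, if k.val % 2 = 1 then 1 else min k (-k))

/-- The normal form for two orbits whose base points are exchanged by `b`. -/
def regularNF : Fin 2 × Fin 2 × Fin 8 → Fin 2 × Fin 2 × Fin 8
  | (0, 0, k) => (0, 0, min k (-k))
  | (0, 1, k) => (0, 1, min k (3 * k))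
  | (1, 0, k) => (0, 1, min (-k) (5 * k))
  | (1, 1, k) => (0, 0, min (5 * k) (-5 * k))

theorem orbitRel_iff_of_eq_or {u : Fin 2 → V} {τ nf : Fin 2 × Fin 2 × Fin 8 → Fin 2 × Fin 2 × Fin 8}
    (hτ : ∀ t, orbitRel Γ a u t ↔ orbitRel Γ a u (τ t))
    (hnf : ∀ c d k, nf (c, d, k) = (c, d, k) ∨ nf (c, d, k) = (d, c, -k) ∨
      nf (c, d, k) = τ (c, d, k) ∨ nf (c, d, k) = τ (d, c, -k)) (t : Fin 2 × Fin 2 × Fin 8) :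
    orbitRel Γ a u t ↔ orbitRel Γ a u (nf t) := by
  obtain ⟨c, d, k⟩ := t
  have hs : orbitRel Γ a u (c, d, k) ↔ orbitRel Γ a u (d, c, -k) := h.adj_orbits_swap u c d k
  rcases hnf c d k with e | e | e | e <;> rw [e]
  · exact hs
  · exact hτ _
  · exact hs.trans (hτ _)

theorem not_forall_iff_of_isTwist [Fintype V] (hcard : Fintype.card V < 18) {u : Fin 2 → V}
    (hinj : Function.Injective (orbits a u)) {β : Fin 8 × Fin 2 → Fin 8 × Fin 2}
    (hβ : ∀ x, b (orbits a u x) = orbits a u (β x))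
    {nf : Fin 2 × Fin 2 × Fin 8 → Fin 2 × Fin 2 × Fin 8}
    (hnf : ∀ t, orbitRel Γ a u t ↔ orbitRel Γ a u (nf t))
    {σ : Fin 8 × Fin 2 → Fin 8 × Fin 2}
    {E : List ((Fin 2 × Fin 2 × Fin 8) × (Fin 2 × Fin 2 × Fin 8))} (hσ : IsTwist β nf σ E)
    (hout : ∀ w, b w = w → ∀ x, Γ.Adj w (u (σ x).2) ↔ Γ.Adj w (u x.2)) :
    ¬ ∀ e ∈ E, (orbitRel Γ a u e.1 ↔ orbitRel Γ a u e.2) := by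
  obtain ⟨hinv, hE, hnot⟩ := hσ
  intro hrel
  refine hnot (h.exists_eq_of_orbits hcard hinj hβ hinv (fun x y => ?_) hout)
  rw [h.adj_orbits, h.adj_orbits]
  change orbitRel Γ a u (offset (σ x) (σ y)) ↔ orbitRel Γ a u (offset x y)
  rw [hnf, hnf (offset x y)]
  rcases hE x y with e | e | e
  · rw [e]
  · exact hrel _ e
  · exact (hrel _ e).symm

theorem false_of_fixed_of_fixed [Fintype V] (hcard : Fintype.card V < 18) {v w : V}
    (hv : (a ^ 4) v ≠ v) (hw : (a ^ 4) w ≠ w) (hbv : b v = v) (hbw : b w = w)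
    (hne : ∀ k : Fin 8, w ≠ (a ^ k.val) v) : False := by
  let u : Fin 2 → V := ![v, w]
  have hbu : ∀ c, b (u c) = u c := Fin.forall_fin_two.2 ⟨hbv, hbw⟩
  have hinj : Function.Injective (orbits a u) :=
    h.orbits_injective (Fin.forall_fin_two.2 ⟨hv, hw⟩) hne
  have hβ : ∀ x, b (orbits a u x) = orbits a u (5 * x.1, x.2) := fun x => by
    rw [orbits, h.b_pow_val, hbu]
    rfl
  have hnf := h.orbitRel_iff_of_eq_or (u := u) (τ := fun t => (t.1, t.2.1, 5 * t.2.2))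
    (nf := fixedNF) (fun t => by rw [orbitRel, ← h.adj_b, hbu, hβ]; rfl) (by decide +kernel)
  have key := fun (σ : Fin 8 × Fin 2 → Fin 8) E hσ =>
    h.not_forall_iff_of_isTwist hcard hinj hβ hnf (σ := fun x => (σ x, x.2)) (E := E) hσ
      fun _ _ _ => Iff.rfl
  have h₁ := key (fun x => if x.1.val % 2 = 0 then -x.1 else x.1)
    [((0, 1, 2), (0, 1, 6))] (by decide +kernel)
  have h₂ := key (fun x => if x.1.val % 2 = 0 then if x.2 = 0 then -x.1 else 4 - x.1 else x.1)
    [((0, 1, 0), (0, 1, 4))] (by decide +kernel)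
  have h₃ := key (fun x => if x.2 = 0 then -x.1 else 2 - x.1)
    [((0, 1, 0), (0, 1, 2)), ((0, 1, 4), (0, 1, 6))] (by decide +kernel)
  have h₄ := key (fun x => if x.2 = 0 then -x.1 else 6 - x.1)
    [((0, 1, 0), (0, 1, 6)), ((0, 1, 2), (0, 1, 4))] (by decide +kernel)
  simp only [List.forall_mem_cons, List.not_mem_nil, false_imp_iff, implies_true, and_true]
    at h₁ h₂ h₃ h₄
  tauto

theorem false_of_regular [Fintype V] (hcard : Fintype.card V < 18) {v : V}
    (hv : (a ^ 4) v ≠ v) (hne : ∀ k : Fin 8, b v ≠ (a ^ k.val) v) : False := by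
  let u : Fin 2 → V := ![v, b v]
  have hbu : ∀ c, b (u c) = u (c + 1) := Fin.forall_fin_two.2 ⟨rfl, h.b_b v⟩
  have hbv : (a ^ 4) (b v) ≠ b v := fun h' => hv <| by
    have h4 := h.b_pow 4 (b v)
    rw [h', h.b_b, pow_mul', ← pow_mul, show 4 * 5 = 8 + 8 + 4 by rfl, pow_add, pow_add,
      h.a_pow_eight, one_mul, one_mul] at h4
    exact h4.symm
  have hinj : Function.Injective (orbits a u) :=
    h.orbits_injective (Fin.forall_fin_two.2 ⟨hv, hbv⟩) hne
  have hβ : ∀ x, b (orbits a u x) = orbits a u (5 * x.1, x.2 + 1) := fun x => by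
    rw [orbits, h.b_pow_val, hbu]
    rfl
  have hout : ∀ w, b w = w → ∀ c d, Γ.Adj w (u c) ↔ Γ.Adj w (u d) := by
    intro w hw
    have h01 : Γ.Adj w (u 0) ↔ Γ.Adj w (u 1) := by
      rw [← h.adj_b, hw, hbu]
      rfl
    simp [Fin.forall_fin_two, h01]
  have hnf := h.orbitRel_iff_of_eq_or (u := u) (τ := fun t => (t.1 + 1, t.2.1 + 1, 5 * t.2.2))
    (nf := regularNF) (fun t => by rw [orbitRel, ← h.adj_b, hbu, hβ]; rfl) (by decide +kernel)
  have key := fun σ E hσ =>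
    h.not_forall_iff_of_isTwist hcard hinj hβ hnf (σ := σ) (E := E) hσ
      fun w hw _ => hout w hw _ _
  have h₁ := key (fun x => (-x.1, x.2)) [((0, 1, 1), (0, 1, 5))] (by decide +kernel)
  have h₂ := key (fun x => (3 * x.1, x.2)) [((0, 0, 1), (0, 0, 3))] (by decide +kernel)
  have h₃ := key
    (fun x => if x.1.val % 2 = 0 then (3 * x.1, x.2) else (3 * x.1 + 6, x.2 + 1))
    [((0, 0, 1), (0, 1, 1)), ((0, 0, 3), (0, 1, 5))] (by decide +kernel)
  have h₄ := key
    (fun x => if x.1.val % 2 = 0 then (3 * x.1, x.2) else (3 * x.1 + 2, x.2 + 1))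
    [((0, 0, 1), (0, 1, 5)), ((0, 0, 3), (0, 1, 1))] (by decide +kernel)
  simp only [List.forall_mem_cons, List.not_mem_nil, false_imp_iff, implies_true, and_true]
    at h₁ h₂ h₃ h₄
  tauto

theorem le_card [Fintype V] : 18 ≤ Fintype.card V := by
  by_contra! hcard
  have hfix : ∀ v, (a ^ 4) v ≠ v → ∃ m : ℕ, b ((a ^ m) v) = (a ^ m) v := fun v hv => by
    by_contra hv'
    refine h.false_of_regular hcard hv fun k hk => hv' ?_
    exact h.exists_fixed hv hk
  obtain ⟨v₀, hv₀⟩ : ∃ v, (a ^ 4) v ≠ v := by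
    by_contra! hall
    exact h.a_pow_four_ne_one (Equiv.ext hall)
  obtain ⟨m, hm⟩ := hfix v₀ hv₀
  have hv := pow_four_pow_ne hv₀ m
  obtain ⟨w₀, hw₀, hne⟩ := h.exists_second_orbit hv hm
  obtain ⟨l, hl⟩ := hfix w₀ hw₀
  refine h.false_of_fixed_of_fixed hcard hv (pow_four_pow_ne hw₀ l) hm hl fun k hk => ?_
  let l' : Fin 8 := Fin.ofNat 8 l
  have hl' : a ^ l = a ^ l'.val := pow_eq_pow_mod l h.a_pow_eight
  refine hne (k - l') ((a ^ l).injective ?_)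
  rw [hk, hl', ← h.pow_add_apply, add_sub_cancel]

end IsModularPair

open ModularSixteen in
theorem isModularPair_of_mulEquiv {Γ : SimpleGraph V} (e : (Γ ≃g Γ) ≃* G16') :
    IsModularPair Γ (e.symm a).toEquiv (e.symm b).toEquiv := by
  let F : (Γ ≃g Γ) →* Perm V := ⟨⟨RelIso.toEquiv, rfl⟩, fun _ _ => rfl⟩
  have hF : Function.Injective F := RelIso.toEquiv_injective
  let φ : G16' →* Perm V := F.comp e.symm.toMonoidHom
  have hφ : Function.Injective φ := hF.comp e.symm.injective
  exact
    { adj_a := fun _ _ => (e.symm a).map_rel_iff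
      adj_b := fun _ _ => (e.symm b).map_rel_iff
      a_pow_eight := by
        change φ a ^ 8 = 1
        rw [← map_pow, a_pow_eight, map_one]
      b_sq := by
        change φ b ^ 2 = 1
        rw [← map_pow, b_sq, map_one]
      b_mul_a := by
        change φ b * φ a = φ a ^ 5 * φ b
        rw [← map_pow, ← map_mul, ← map_mul, b_mul_a]
      a_pow_four_ne_one := by
        change φ a ^ 4 ≠ 1
        rw [← map_pow, Ne, map_eq_one_iff φ hφ]
        exact a_pow_four_ne_one
      exists_eq := fun σ hσ => by
        let f : Γ ≃g Γ := ⟨σ, fun {x y} => hσ x y⟩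
        obtain ⟨i, j, hij⟩ := exists_eq_pow_mul_pow (e f)
        refine ⟨i, j, ?_⟩
        change σ = φ a ^ i.val * φ b ^ j.val
        rw [← map_pow, ← map_pow, ← map_mul, ← hij]
        change σ = F (e.symm (e f))
        rw [e.symm_apply_apply]
        rfl }

end LowerBound

/-- Proposition: the group `G′₁₆ = ⟨a, b ∣ a⁸ = b² = 1, b a b⁻¹ = a⁵⟩` of
order 16 satisfies `α(G′₁₆) = 18`. -/
theorem alpha_G16' : graphAlpha G16' = 18 := by
  have hmem : 18 ∈ {n : ℕ | ∃ Γ : SimpleGraph (Fin n), Nonempty ((Γ ≃g Γ) ≃* G16')} :=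
    ⟨ModularSixteen.graph, ⟨(MulEquiv.ofBijective ModularSixteen.toAut
      ModularSixteen.toAut_bijective).symm⟩⟩
  refine le_antisymm (Nat.sInf_le hmem) (le_csInf ⟨18, hmem⟩ ?_)
  rintro n ⟨Γ, ⟨e⟩⟩
  simpa using (isModularPair_of_mulEquiv e).le_card
end

section
/- The alternating group A₄ on 4 letters satisfies α(A₄) = 16. -/
/-- A model of `A₄` on which decision procedures are fast: the affine maps `w ↦ v + ωⁱ w` of the
field with four elements, whose elements `0, 1, ω, ω²` are encoded as `0, 1, 2, 3`. -/
def AffF4 : Type := Fin 4 × Fin 3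

namespace AffF4

instance : DecidableEq AffF4 := inferInstanceAs (DecidableEq (Fin 4 × Fin 3))

instance : Fintype AffF4 := inferInstanceAs (Fintype (Fin 4 × Fin 3))

/-- Multiplication by `ωⁱ` on the field with four elements. -/
def rot (i : Fin 3) (v : Fin 4) : Fin 4 :=
  if v = 0 then 0 else ⟨1 + (v.val + 2 + i.val) % 3, by omega⟩

instance : Mul AffF4 := ⟨fun g h => (g.1 ^^^ rot g.2 h.1, g.2 + h.2)⟩

instance : One AffF4 := ⟨((0, 0) : Fin 4 × Fin 3)⟩

instance : Inv AffF4 := ⟨fun g => (rot (-g.2) g.1, -g.2)⟩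

instance : Group AffF4 :=
  Group.ofLeftAxioms (by decide +kernel) (by decide +kernel) (by decide +kernel)

/-- The map `w ↦ ωⁱ w`. -/
def rotation (i : Fin 3) : AffF4 := ((0, i) : Fin 4 × Fin 3)

/-- The translation `w ↦ v + w`. -/
def translation (v : Fin 4) : AffF4 := ((v, 0) : Fin 4 × Fin 3)

/-- The outer automorphism induced by the Frobenius map, which exchanges `ω` and `ω²`. -/
def frob : AffF4 →* AffF4 where
  toFun g := translation (![0, 1, 3, 2] g.1) * rotation (-g.2)
  map_one' := by decide +kernel
  map_mul' := by decide +kernel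

/-- The affine action on the field with four elements. -/
def toPerm : AffF4 →* Equiv.Perm (Fin 4) where
  toFun g := ⟨fun w => g.1 ^^^ rot g.2 w, fun w => g⁻¹.1 ^^^ rot g⁻¹.2 w,
    by revert g; unfold Function.LeftInverse; decide +kernel,
    by revert g; unfold Function.RightInverse Function.LeftInverse; decide +kernel⟩
  map_one' := by ext w; revert w; decide +kernel
  map_mul' g h := by ext w; revert g h w; decide +kernel

theorem toPerm_injective : Function.Injective toPerm := by
  have h : ∀ g h : AffF4, (∀ w, toPerm g w = toPerm h w) → g = h := by decide +kernel
  exact fun g g' e => h g g' fun w => by rw [e]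

theorem toPerm_mem (g : AffF4) : toPerm g ∈ alternatingGroup (Fin 4) := by
  rw [Equiv.Perm.mem_alternatingGroup]
  revert g
  decide +kernel

/-- The affine model is isomorphic to the alternating group. -/
noncomputable def equivAlternating : AffF4 ≃* alternatingGroup (Fin 4) :=
  MulEquiv.ofBijective (toPerm.codRestrict _ toPerm_mem) <| by
    rw [Fintype.bijective_iff_injective_and_card]
    refine ⟨fun g h e => toPerm_injective (congrArg Subtype.val e), ?_⟩
    rw [← Nat.card_eq_fintype_card (α := alternatingGroup (Fin 4)), nat_card_alternatingGroup, Nat.card_eq_fintype_card]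
    decide

end AffF4

/-- The transitive actions of `A₄` up to isomorphism, named by their degree. -/
inductive OrbitType
  | one | three | four | six | twelve

namespace OrbitType

/-- The number of points of an orbit. -/
def size : OrbitType → ℕ
  | one => 1
  | three => 3
  | four => 4
  | six => 6
  | twelve => 12

/-- Membership in a chosen point stabilizer. -/
def Stab : OrbitType → AffF4 → Prop
  | one, _ => True
  | three, g => g.2 = 0
  | four, g => g.1 = 0
  | six, g => g.2 = 0 ∧ (g.1 = 0 ∨ g.1 = 1)
  | twelve, g => g = 1

instance : ∀ t g, Decidable (Stab t g)
  | one, _ => inferInstanceAs (Decidable True)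
  | three, g => inferInstanceAs (Decidable (g.2 = 0))
  | four, g => inferInstanceAs (Decidable (g.1 = 0))
  | six, g => inferInstanceAs (Decidable (g.2 = 0 ∧ (g.1 = 0 ∨ g.1 = 1)))
  | twelve, g => inferInstanceAs (Decidable (g = 1))

theorem card_stab_mul_size (t : OrbitType) :
    Fintype.card {g : AffF4 // t.Stab g} * t.size = 12 := by
  cases t <;> decide +kernel

end OrbitType

open OrbitType

/-- Every subgroup of `A₄` is conjugate to one of the chosen stabilizers. -/
theorem AffF4.exists_conj_stab (H : Subgroup AffF4) :
    ∃ (g : AffF4) (t : OrbitType), ∀ h, g * h * g⁻¹ ∈ H ↔ t.Stab h := by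
  by_cases h3 : ∃ x ∈ H, x.2 ≠ 0
  · obtain ⟨x, hx, hx2⟩ := h3
    have key : ∀ x : AffF4, x.2 ≠ 0 → ∃ g : AffF4,
        ∀ h, four.Stab h → ∃ k : Fin 3, g * h * g⁻¹ = x ^ k.val := by decide +kernel
    obtain ⟨g, hg⟩ := key x hx2
    have hc : ∀ h, four.Stab h → g * h * g⁻¹ ∈ H := fun h hh => by
      obtain ⟨k, hk⟩ := hg h hh
      exact hk ▸ H.pow_mem hx _
    by_cases h4 : ∀ h, g * h * g⁻¹ ∈ H → four.Stab h
    · exact ⟨g, four, fun h => ⟨h4 h, hc h⟩⟩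
    · push Not at h4
      obtain ⟨y, hy, hy4⟩ := h4
      have gen : ∀ y : AffF4, ¬ four.Stab y → ∀ h : AffF4, ∃ a b c : Fin 3, ∃ d : Fin 2,
          h = rotation a * y * rotation b * y ^ d.val * rotation c := by decide +kernel
      refine ⟨g, one, fun h => ⟨fun _ => trivial, fun _ => ?_⟩⟩
      obtain ⟨a, b, c, d, e⟩ := gen y hy4 h
      let K : Subgroup AffF4 := H.comap (MulAut.conj g).toMonoidHom
      have hK : ∀ z, z ∈ K ↔ g * z * g⁻¹ ∈ H := fun z => Iff.rfl
      have h0 : ∀ a : Fin 3, rotation a ∈ K := fun a => hc (rotation a) rfl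
      have hyK : y ∈ K := hy
      rw [← hK, e]
      exact K.mul_mem (K.mul_mem (K.mul_mem (K.mul_mem (h0 a) hyK) (h0 b)) (K.pow_mem hyK _)) (h0 c)
  · push Not at h3
    by_cases h1 : ∃ x ∈ H, x ≠ 1
    · obtain ⟨x, hx, hx1⟩ := h1
      have key : ∀ x : AffF4, x.2 = 0 → x ≠ 1 → ∃ g : AffF4, ∀ h, six.Stab h →
          g * h * g⁻¹ = 1 ∨ g * h * g⁻¹ = x := by decide +kernel
      obtain ⟨g, hg⟩ := key x (h3 x hx) hx1
      have hc : ∀ h, six.Stab h → g * h * g⁻¹ ∈ H := fun h hh => by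
        rcases hg h hh with e | e <;> rw [e]
        exacts [H.one_mem, hx]
      have hV : ∀ g h : AffF4, (g * h * g⁻¹).2 = 0 → h.2 = 0 := by decide +kernel
      by_cases h4 : ∀ h, g * h * g⁻¹ ∈ H → six.Stab h
      · exact ⟨g, six, fun h => ⟨h4 h, hc h⟩⟩
      · push Not at h4
        obtain ⟨y, hy, hy6⟩ := h4
        have gen : ∀ y : AffF4, y.2 = 0 → ¬ six.Stab y → ∀ h : AffF4, h.2 = 0 →
            ∃ z, six.Stab z ∧ (h = z ∨ h = y * z) := by decide +kernel
        refine ⟨g, three, fun h => ⟨fun hh => hV g h (h3 _ hh), fun hh => ?_⟩⟩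
        obtain ⟨z, hz, rfl | rfl⟩ := gen y (hV g y (h3 _ hy)) hy6 h hh
        · exact hc _ hz
        · have e : g * (y * z) * g⁻¹ = g * y * g⁻¹ * (g * z * g⁻¹) := by group
          rw [e]
          exact H.mul_mem hy (hc _ hz)
    · push Not at h1
      refine ⟨1, twelve, fun h => ?_⟩
      simp only [one_mul, inv_one, mul_one]
      exact ⟨h1 h, fun e => (show h = 1 from e) ▸ H.one_mem⟩

/-- A family of base points, one in each orbit, whose stabilizers are the chosen ones. -/
structure OrbitBases (X : Type*) [MulAction AffF4 X] (I : Type*) where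
  base : I → X
  type : I → OrbitType
  cover : ∀ x, ∃ i, ∃ g : AffF4, x = g • base i
  eq_of_smul_eq : ∀ {i j} {g h : AffF4}, g • base i = h • base j → i = j
  smul_base : ∀ {i} {g : AffF4}, g • base i = base i ↔ (type i).Stab g

theorem OrbitBases.nonempty (X : Type*) [MulAction AffF4 X] :
    Nonempty (OrbitBases X (MulAction.orbitRel.Quotient AffF4 X)) := by
  have h : ∀ q : MulAction.orbitRel.Quotient AffF4 X, ∃ (p : X) (t : OrbitType),
      Quotient.mk _ p = q ∧ ∀ g : AffF4, g • p = p ↔ t.Stab g := by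
    intro q
    induction q using Quotient.inductionOn with | _ x
    obtain ⟨g, t, h⟩ := AffF4.exists_conj_stab (MulAction.stabilizer AffF4 x)
    refine ⟨g⁻¹ • x, t, Quotient.sound ⟨g⁻¹, rfl⟩, fun k => ?_⟩
    rw [← h, MulAction.mem_stabilizer_iff, eq_inv_smul_iff, smul_smul, smul_smul, mul_assoc]
  choose p t hp ht using h
  refine ⟨⟨p, t, fun x => ?_, fun {i j g h} e => ?_, ht _ _⟩⟩
  · obtain ⟨g, hg⟩ := Quotient.exact (hp (Quotient.mk _ x))
    exact ⟨_, g⁻¹, by rw [← hg]; simp⟩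
  · rw [← hp i, ← hp j]
    refine Quotient.sound ⟨g⁻¹ * h, ?_⟩
    change (g⁻¹ * h) • p j = p i
    rw [mul_smul, ← e, inv_smul_smul]

namespace OrbitBases

variable {X : Type*} [MulAction AffF4 X] {I : Type*} (D : OrbitBases X I)


theorem smul_eq_smul_iff {i : I} {g h : AffF4} :
    g • D.base i = h • D.base i ↔ (D.type i).Stab (g⁻¹ * h) := by
  rw [← D.smul_base, mul_smul, inv_smul_eq_iff, eq_comm]

theorem sum_size_le [Fintype X] (T : Finset I) : ∑ i ∈ T, (D.type i).size ≤ Fintype.card X := by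
  classical
  have hcard : ∀ i, (Finset.univ.image fun g : AffF4 => g • D.base i).card = (D.type i).size := by
    intro i
    have h1 := MulAction.card_orbit_mul_card_stabilizer_eq_card_group AffF4 (D.base i)
    have h2 := card_stab_mul_size (D.type i)
    have h3 : Fintype.card (MulAction.stabilizer AffF4 (D.base i)) =
        Fintype.card {g : AffF4 // (D.type i).Stab g} :=
      Fintype.card_congr (Equiv.subtypeEquivRight fun g => D.smul_base)
    have h4 : Fintype.card (MulAction.orbit AffF4 (D.base i)) =
        (Finset.univ.image fun g : AffF4 => g • D.base i).card := by
      rw [← Set.toFinset_card]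
      congr 1
      ext x
      simp [MulAction.mem_orbit_iff]
    have h5 : Fintype.card AffF4 = 12 := by decide
    rw [h3, h4, h5, ← h2, mul_comm] at h1
    refine Nat.eq_of_mul_eq_mul_left (Nat.pos_of_ne_zero fun h0 => ?_) h1
    rw [h0] at h2
    omega
  rw [← Finset.sum_congr rfl fun i _ => hcard i, ← Finset.card_biUnion]
  · exact Finset.card_le_univ _
  · intro i _ j _ hij
    rw [Function.onFun, Finset.disjoint_left]
    intro x hx hy
    simp only [Finset.mem_image, Finset.mem_univ, true_and] at hx hy
    obtain ⟨g, rfl⟩ := hx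
    obtain ⟨h, hh⟩ := hy
    exact hij (D.eq_of_smul_eq hh.symm)

/-- An action with point stabilizers containing the Klein four-group is not faithful. -/
theorem exists_type_ne [FaithfulSMul AffF4 X] : ∃ i, D.type i ≠ one ∧ D.type i ≠ three := by
  by_contra! hc
  have h : AffF4.translation 1 = 1 := by
    refine FaithfulSMul.eq_of_smul_eq_smul (α := X) fun x => ?_
    obtain ⟨i, g, rfl⟩ := D.cover x
    rw [one_smul, smul_smul, eq_comm, D.smul_eq_smul_iff]
    by_cases hi : D.type i = one
    · rw [hi]
      trivial
    · rw [hc i hi]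
      clear * -
      revert g
      decide +kernel
  revert h
  decide

variable (Γ : SimpleGraph X)

/-- Adjacency of base points up to a group element. -/
def Rel (i j : I) (g : AffF4) : Prop := Γ.Adj (D.base i) (g • D.base j)

variable {Γ}

theorem adj_iff_rel
    (hinv : ∀ (g : AffF4) x y, Γ.Adj (g • x) (g • y) ↔ Γ.Adj x y)
    {i j : I} {g h : AffF4} :
    Γ.Adj (g • D.base i) (h • D.base j) ↔ D.Rel Γ i j (g⁻¹ * h) := by
  rw [Rel, ← hinv g (D.base i), smul_smul, mul_inv_cancel_left]

theorem rel_inv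
    (hinv : ∀ (g : AffF4) x y, Γ.Adj (g • x) (g • y) ↔ Γ.Adj x y)
    {i j : I} {g : AffF4} : D.Rel Γ i j g⁻¹ ↔ D.Rel Γ j i g := by
  rw [Rel, Rel, ← hinv g, smul_inv_smul, Γ.adj_comm]

theorem rel_congr
    (hinv : ∀ (g : AffF4) x y, Γ.Adj (g • x) (g • y) ↔ Γ.Adj x y)
    {i j : I} {g h : AffF4}
    (H : ∃ a, (D.type i).Stab a ∧ (D.type j).Stab ((a * g)⁻¹ * h)) :
    D.Rel Γ i j g ↔ D.Rel Γ i j h := by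
  obtain ⟨a, ha, hb⟩ := H
  rw [← D.smul_base] at ha
  rw [← D.smul_eq_smul_iff] at hb
  rw [Rel, Rel, ← hb, mul_smul]
  nth_rewrite 2 [← ha]
  rw [hinv]

/-- If the automorphisms of `Γ` are those given by the group, then a map which moves points inside
orbits and preserves adjacency is given by the group. -/
theorem exists_eq_smul_of_rel
    (hinv : ∀ (g : AffF4) x y, Γ.Adj (g • x) (g • y) ↔ Γ.Adj x y)
    [Finite X] (hfull : ∀ σ : Γ ≃g Γ, ∃ g : AffF4, ∀ x, σ x = g • x)
    (f : I → AffF4 → AffF4)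
    (hf : ∀ i g h, (D.type i).Stab ((f i g)⁻¹ * f i h) ↔ (D.type i).Stab (g⁻¹ * h))
    (hr : ∀ i j g h, D.Rel Γ i j ((f i g)⁻¹ * f j h) ↔ D.Rel Γ i j (g⁻¹ * h)) :
    ∃ c : AffF4, ∀ i g, (D.type i).Stab ((c * g)⁻¹ * f i g) := by
  choose ix gx hx using D.cover
  let σ : X → X := fun x => f (ix x) (gx x) • D.base (ix x)
  have hσ : ∀ i g, σ (g • D.base i) = f i g • D.base i := by
    intro i g
    have e := hx (g • D.base i)
    have e' := D.eq_of_smul_eq e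
    simp only [σ]
    rw [← e'] at e ⊢
    rw [D.smul_eq_smul_iff, hf, ← D.smul_eq_smul_iff, ← e]
  have hinj : Function.Injective σ := by
    intro x y hxy
    obtain ⟨i, g, rfl⟩ := D.cover x
    obtain ⟨j, h, rfl⟩ := D.cover y
    rw [hσ, hσ] at hxy
    obtain rfl := D.eq_of_smul_eq hxy
    rwa [D.smul_eq_smul_iff, hf, ← D.smul_eq_smul_iff] at hxy
  obtain ⟨c, hc⟩ := hfull ⟨Equiv.ofBijective σ (Finite.injective_iff_bijective.mp hinj), by
    intro x y
    obtain ⟨i, g, rfl⟩ := D.cover x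
    obtain ⟨j, h, rfl⟩ := D.cover y
    simp only [Equiv.ofBijective_apply]
    rw [hσ, hσ, D.adj_iff_rel hinv, D.adj_iff_rel hinv, hr]⟩
  refine ⟨c, fun i g => ?_⟩
  rw [← D.smul_eq_smul_iff, mul_smul, ← hc]
  exact hσ i g

/-- If all orbits have size `1`, `3` or `6`, there is an automorphism commuting with the group. -/
theorem exists_four_or_twelve
    (hinv : ∀ (g : AffF4) x y, Γ.Adj (g • x) (g • y) ↔ Γ.Adj x y)
    [Finite X] (hfull : ∀ σ : Γ ≃g Γ, ∃ g : AffF4, ∀ x, σ x = g • x)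
    [FaithfulSMul AffF4 X] :
    ∃ i, D.type i = four ∨ D.type i = twelve := by
  by_contra! hc
  obtain ⟨i, hi1, hi3⟩ := D.exists_type_ne
  have hd : ∀ i, D.type i = one ∨ D.type i = three ∨ D.type i = six := fun i => by
    have := hc i
    cases h : D.type i <;> simp_all
  let f : OrbitType → AffF4 → AffF4
    | six, g => g * AffF4.translation 2
    | _, g => g
  obtain ⟨c, h⟩ := D.exists_eq_smul_of_rel hinv hfull (fun i => f (D.type i))
    (fun i g h => by
      revert g h
      rcases hd i with e | e | e <;> rw [e] <;> decide +kernel)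
    (fun i j g h => by
      refine (D.rel_congr hinv ?_).symm
      revert g h
      rcases hd i with e | e | e <;> rcases hd j with e' | e' | e' <;> rw [e, e'] <;>
        decide +kernel)
  have hi := h i
  rw [((hd i).resolve_left hi1).resolve_left hi3] at hi
  clear h
  revert c
  decide +kernel

/-- If all orbits have size `1`, `3` or `4`, there is an automorphism acting as an odd permutation
on all orbits of size `4` and fixing the other points. -/
theorem exists_six_or_twelve
    (hinv : ∀ (g : AffF4) x y, Γ.Adj (g • x) (g • y) ↔ Γ.Adj x y)
    [Finite X] (hfull : ∀ σ : Γ ≃g Γ, ∃ g : AffF4, ∀ x, σ x = g • x)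
    [FaithfulSMul AffF4 X] :
    ∃ i, D.type i = six ∨ D.type i = twelve := by
  by_contra! hc
  obtain ⟨i, hi1, hi3⟩ := D.exists_type_ne
  have hd : ∀ i, D.type i = one ∨ D.type i = three ∨ D.type i = four := fun i => by
    have := hc i
    cases h : D.type i <;> simp_all
  let f : OrbitType → AffF4 → AffF4
    | four, g => AffF4.frob g
    | _, g => g
  obtain ⟨c, h⟩ := D.exists_eq_smul_of_rel hinv hfull (fun i => f (D.type i))
    (fun i g h => by
      revert g h
      rcases hd i with e | e | e <;> rw [e] <;> decide +kernel)
    (fun i j g h => by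
      refine (D.rel_congr hinv ?_).symm
      revert g h
      rcases hd i with e | e | e <;> rcases hd j with e' | e' | e' <;> rw [e, e'] <;>
        decide +kernel)
  have hi := h i
  rw [((hd i).resolve_left hi1).resolve_left hi3] at hi
  clear h
  revert c
  decide +kernel

/-- Suppose that at most one orbit has size `3`, that at most one other orbit has neither size `1`
nor size `4`, and that the endomorphism `φ` preserves the relations between orbits of size other
than `3`. Then `φ` induces an automorphism of `Γ`. -/
theorem exists_of_twist
    (hinv : ∀ (g : AffF4) x y, Γ.Adj (g • x) (g • y) ↔ Γ.Adj x y)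
    [Finite X] (hfull : ∀ σ : Γ ≃g Γ, ∃ g : AffF4, ∀ x, σ x = g • x)
    (φ : AffF4 →* AffF4) (m : I)
    (hφ : (∀ g, (φ g).2 = g.2) ∨ ∀ g, (φ g).2 = -g.2)
    (hm : ∀ i, i ≠ m → D.type i = one ∨ D.type i = three ∨ D.type i = four)
    (h3 : ∀ i j, D.type i = three → D.type j = three → i = j) 
    (hst : ∀ i g, (D.type i).Stab (φ g) ↔ (D.type i).Stab g)
    (hrel : ∀ i j g, D.type i ≠ three → D.type j ≠ three →
      (D.Rel Γ i j (φ g) ↔ D.Rel Γ i j g)) :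
    ∃ c : AffF4, ∀ i, D.type i ≠ three → ∀ g, (D.type i).Stab ((c * g)⁻¹ * φ g) := by
  classical
  have hsnd : ∀ g : AffF4, ∀ k : Fin 3, (g * AffF4.rotation k).2 = g.2 + k := by decide +kernel
  obtain ⟨k, hk⟩ : ∃ k, ∀ q, D.type q = three → ∀ g,
      (D.Rel Γ m q (φ g * AffF4.rotation k) ↔ D.Rel Γ m q g) := by
    by_cases hq : ∃ q, D.type q = three
    · obtain ⟨q, hq⟩ := hq
      have hfst : ∀ g, D.Rel Γ m q (AffF4.rotation g.2) ↔ D.Rel Γ m q g := fun g => by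
        refine D.rel_congr hinv ⟨1, ?_, ?_⟩
        · rw [← D.smul_base, one_smul]
        · rw [hq]
          revert g
          decide +kernel
      have aux : ∀ b : Fin 3 → Bool, ∃ k, ∀ i, b (-i + k) = b i := by decide +kernel
      obtain ⟨k, hk⟩ : ∃ k, ∀ g, D.Rel Γ m q (AffF4.rotation ((φ g).2 + k)) ↔
          D.Rel Γ m q (AffF4.rotation g.2) := by
        rcases hφ with hφ | hφ
        · exact ⟨0, fun g => by rw [hφ, add_zero]⟩
        · obtain ⟨k, hk⟩ := aux fun i => decide (D.Rel Γ m q (AffF4.rotation i))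
          exact ⟨k, fun g => by rw [hφ]; simpa using hk g.2⟩
      refine ⟨k, fun q' hq' g => ?_⟩
      rw [h3 q' q hq' hq, ← hfst, hsnd, hk, hfst]
    · push Not at hq
      exact ⟨0, fun q h => absurd h (hq q)⟩
  let f : I → AffF4 → AffF4 := fun i g =>
    if D.type i = three then φ g * AffF4.rotation k else φ g
  have f3 : ∀ i g, D.type i = three → f i g = φ g * AffF4.rotation k := fun i g h => if_pos h
  have fn : ∀ i g, D.type i ≠ three → f i g = φ g := fun i g h => if_neg h
  have hr3 : ∀ i j g h, D.type i ≠ three → D.type j = three →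
      (D.Rel Γ i j ((f i g)⁻¹ * f j h) ↔ D.Rel Γ i j (g⁻¹ * h)) := by
    intro i j g h hi hj
    rw [fn i g hi, f3 j h hj, ← map_inv, ← mul_assoc, ← map_mul]
    by_cases him : i = m
    · rw [him, hk j hj]
    · refine D.rel_congr hinv ?_
      generalize φ (g⁻¹ * h) * AffF4.rotation k = u
      generalize g⁻¹ * h = v
      revert u v
      rcases hm i him with e | e | e
      · rw [e, hj]
        decide +kernel
      · exact absurd e hi
      · rw [e, hj]
        decide +kernel
  obtain ⟨c, hc⟩ := D.exists_eq_smul_of_rel hinv hfull f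
    (fun i g h => by
      by_cases hi : D.type i = three
      · have e : ∀ x : AffF4, three.Stab ((AffF4.rotation k)⁻¹ * x * AffF4.rotation k) ↔
            three.Stab x := by clear * -; revert k; decide +kernel
        rw [f3 i g hi, f3 i h hi, ← hst i (g⁻¹ * h), hi, ← e (φ (g⁻¹ * h)), map_mul, map_inv]
        group
      · rw [fn i g hi, fn i h hi, ← map_inv, ← map_mul, hst])
    (fun i j g h => by
      by_cases hi : D.type i = three <;> by_cases hj : D.type j = three
      · obtain rfl := h3 i j hi hj
        have e : ∀ x y : AffF4, x.2 = y.2 ∨ x.2 = -y.2 →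
            (D.Rel Γ i i x ↔ D.Rel Γ i i y) := by
          have d : ∀ x y : AffF4, x.2 = y.2 → three.Stab ((1 * x)⁻¹ * y) := by decide +kernel
          have d' : ∀ x y : AffF4, x.2 = -y.2 → (x⁻¹).2 = y.2 := by decide +kernel
          have e : ∀ x y : AffF4, x.2 = y.2 → (D.Rel Γ i i x ↔ D.Rel Γ i i y) := fun x y hxy => by
            refine D.rel_congr hinv ⟨1, ?_, ?_⟩
            · rw [← D.smul_base, one_smul]
            · rw [hi]
              exact d x y hxy
          rintro x y (hxy | hxy)
          · exact e x y hxy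
          · rw [← D.rel_inv hinv]
            exact e _ _ (d' x y hxy)
        have d : ∀ x : AffF4, ∀ k,
            ((AffF4.rotation k)⁻¹ * x * AffF4.rotation k).2 = x.2 := by decide +kernel
        have e' : (f i g)⁻¹ * f i h =
            (AffF4.rotation k)⁻¹ * φ (g⁻¹ * h) * AffF4.rotation k := by
          rw [f3 i g hi, f3 i h hi, map_mul, map_inv]
          group
        apply e
        rw [e', d]
        exact hφ.imp (fun H => H _) fun H => H _
      · rw [← D.rel_inv hinv, mul_inv_rev, inv_inv, hr3 j i h g hj hi, ← D.rel_inv hinv,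
          mul_inv_rev, inv_inv]
      · exact hr3 i j g h hi hj
      · rw [fn i g hi, fn j h hj, ← map_inv, ← map_mul, hrel i j _ hi hj])
  refine ⟨c, fun i hi g => ?_⟩
  have := hc i g
  rwa [fn i g hi] at this

end OrbitBases

namespace AffF4

/-- Conjugation, possibly preceded by the Frobenius automorphism. -/
def twist (c : AffF4) (e : Bool) : AffF4 →* AffF4 :=
  (MulAut.conj c).toMonoidHom.comp (if e then frob else MonoidHom.id AffF4)

/-- The index of the pair `{g, g⁻¹}` among the seven such pairs of nontrivial elements. -/
def pairIndex (g : AffF4) : Fin 7 :=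
  if g.2 = 0 then ⟨g.1.val - 1, by omega⟩
  else if g.2 = 1 then ⟨3 + g.1.val, by omega⟩
  else ⟨3 + g⁻¹.1.val, by omega⟩

/-- `A₄` has no graphical regular representation: every inverse-closed subset is preserved by a
nontrivial automorphism. -/
theorem exists_twist_preserving (r : AffF4 → Prop) (hr : ∀ g, r g⁻¹ ↔ r g) :
    ∃ c e, (∃ g, twist c e g ≠ g) ∧ ∀ g, r (twist c e g) ↔ r g := by
  classical
  have key : ∀ b₀ b₁ b₂ b₃ b₄ b₅ b₆ : Bool, ∃ c e, (∃ g, twist c e g ≠ g) ∧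
      ∀ g, g ≠ 1 → ![b₀, b₁, b₂, b₃, b₄, b₅, b₆] (pairIndex (twist c e g)) =
        ![b₀, b₁, b₂, b₃, b₄, b₅, b₆] (pairIndex g) := by decide +kernel
  have rep : ∀ i : Fin 7, ∃ g, g ≠ 1 ∧ pairIndex g = i := by decide +kernel
  have inj : ∀ g h : AffF4, g ≠ 1 → h ≠ 1 → pairIndex g = pairIndex h → g = h ∨ g = h⁻¹ := by
    decide +kernel
  have hne : ∀ c e g, g ≠ 1 → twist c e g ≠ 1 := by decide +kernel
  choose p hp1 hp using rep
  have hrp : ∀ g, g ≠ 1 → (r g ↔ r (p (pairIndex g))) := fun g hg => by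
    rcases inj g _ hg (hp1 (pairIndex g)) (hp _).symm with e | e
    · rw [← e]
    · rw [← hr (p _), ← e]
  let ρ : Fin 7 → Bool := fun i => decide (r (p i))
  have hρ : ![ρ 0, ρ 1, ρ 2, ρ 3, ρ 4, ρ 5, ρ 6] = ρ := by
    ext i
    fin_cases i <;> rfl
  obtain ⟨c, e, hce, h⟩ := key (ρ 0) (ρ 1) (ρ 2) (ρ 3) (ρ 4) (ρ 5) (ρ 6)
  rw [hρ] at h
  refine ⟨c, e, hce, fun g => ?_⟩
  by_cases hg : g = 1
  · rw [hg, map_one]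
  · rw [hrp _ (hne c e g hg), hrp g hg]
    simpa [ρ] using h g hg

end AffF4

namespace OrbitBases

variable {X : Type*} [MulAction AffF4 X] {I : Type*} (D : OrbitBases X I) {Γ : SimpleGraph X}

/-- The case of a regular orbit, where all other orbits have size `1` except possibly one of
size `3`. -/
theorem false_of_twelve
    (hinv : ∀ (g : AffF4) x y, Γ.Adj (g • x) (g • y) ↔ Γ.Adj x y)
    [Finite X] (hfull : ∀ σ : Γ ≃g Γ, ∃ g : AffF4, ∀ x, σ x = g • x)
    (m : I) (h12 : D.type m = twelve)
    (hm : ∀ i, i ≠ m → D.type i = one ∨ D.type i = three)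
    (h3 : ∀ i j, D.type i = three → D.type j = three → i = j) : False := by
  obtain ⟨c, e, ⟨g₀, hg₀⟩, hr⟩ :=
    AffF4.exists_twist_preserving (D.Rel Γ m m) fun g => D.rel_inv hinv
  have hinj : ∀ c e g, AffF4.twist c e g = 1 ↔ g = 1 := by decide +kernel
  have hsnd : ∀ c e, (∀ g, (AffF4.twist c e g).2 = g.2) ∨ ∀ g, (AffF4.twist c e g).2 = -g.2 := by
    decide +kernel
  have hstab : ∀ c e g, three.Stab (AffF4.twist c e g) ↔ three.Stab g := by decide +kernel
  have hone : ∀ i, i ≠ m → D.type i ≠ three → D.type i = one := fun i hi hi3 =>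
    (hm i hi).resolve_right hi3
  obtain ⟨d, hd⟩ := D.exists_of_twist hinv hfull (AffF4.twist c e) m (hsnd c e)
    (fun i hi => (hm i hi).imp_right Or.inl) h3
    (fun i g => by
      by_cases hi : i = m
      · rw [hi, h12]
        exact hinj c e g
      · rcases hm i hi with h | h <;> rw [h]
        exacts [Iff.rfl, hstab c e g])
    (fun i j g hi hj => by
      by_cases him : i = m
      · by_cases hjm : j = m
        · rw [him, hjm, hr]
        · refine D.rel_congr hinv ⟨1, ?_, ?_⟩
          · rw [← D.smul_base, one_smul]
          · rw [hone j hjm hj]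
            trivial
      · refine D.rel_congr hinv ⟨g * (AffF4.twist c e g)⁻¹, ?_, ?_⟩
        · rw [hone i him hi]
          trivial
        · rw [inv_mul_cancel_right, inv_mul_cancel, ← D.smul_base, one_smul])
  have hdm := hd m (by rw [h12]; exact OrbitType.noConfusion)
  rw [h12] at hdm
  have hdm' : ∀ g, AffF4.twist c e g = d * g := fun g => (inv_mul_eq_one.mp (hdm g)).symm
  have hd1 := hdm' 1
  rw [map_one, mul_one] at hd1
  apply hg₀
  rw [hdm', ← hd1, one_mul]

/-- The case of one orbit of size `6`, orbits of size `1` or `4`, and possibly one orbit of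
size `3`. -/
theorem false_of_four_six
    (hinv : ∀ (g : AffF4) x y, Γ.Adj (g • x) (g • y) ↔ Γ.Adj x y)
    [Finite X] (hfull : ∀ σ : Γ ≃g Γ, ∃ g : AffF4, ∀ x, σ x = g • x)
    (k m : I) (h4 : D.type k = four) (h6 : D.type m = six)
    (hm : ∀ i, i ≠ m → D.type i = one ∨ D.type i = three ∨ D.type i = four)
    (h3 : ∀ i j, D.type i = three → D.type j = three → i = j) : False := by
  have hone : ∀ i, i ≠ m → D.type i ≠ three → D.type i = one ∨ D.type i = four :=
    fun i hi hi3 => (hm i hi).imp_right fun h => h.resolve_left hi3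
  obtain ⟨d, hd⟩ := D.exists_of_twist hinv hfull AffF4.frob m (Or.inr (by decide +kernel)) hm h3
    (fun i g => by
      revert g
      by_cases hi : i = m
      · rw [hi, h6]
        decide +kernel
      · rcases hm i hi with h | h | h <;> rw [h] <;> decide +kernel)
    (fun i j g hi hj => by
      by_cases hij : i = m ∧ j = m
      · rw [hij.1, hij.2]
        have key : ∀ g, (∃ a, six.Stab a ∧ six.Stab ((a * AffF4.frob g)⁻¹ * g)) ∨
            ∃ a, six.Stab a ∧ six.Stab ((a * (AffF4.frob g)⁻¹)⁻¹ * g) := by decide +kernel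
        rcases key g with h | h <;> rw [← h6] at h
        · exact D.rel_congr hinv h
        · rw [← D.rel_inv hinv]
          exact D.rel_congr hinv h
      · refine D.rel_congr hinv ?_
        revert g
        by_cases him : i = m
        · rcases hone j (fun e => hij ⟨him, e⟩) hj with e | e <;> rw [him, e, h6] <;>
            decide +kernel
        · by_cases hjm : j = m
          · rcases hone i him hi with e | e <;> rw [hjm, e, h6] <;> decide +kernel
          · rcases hone i him hi with e | e <;> rcases hone j hjm hj with e' | e' <;>
              rw [e, e'] <;> decide +kernel)
  have hdk := hd k (by rw [h4]; exact OrbitType.noConfusion)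
  rw [h4] at hdk
  clear hd
  revert d
  decide +kernel

end OrbitBases

/-- A graph whose automorphisms are exactly given by a faithful action of `A₄` has at least `16`
vertices. -/
theorem sixteen_le_card {X : Type*} [Fintype X] [MulAction AffF4 X] [FaithfulSMul AffF4 X]
    (Γ : SimpleGraph X) (hinv : ∀ (g : AffF4) x y, Γ.Adj (g • x) (g • y) ↔ Γ.Adj x y)
    (hfull : ∀ σ : Γ ≃g Γ, ∃ g : AffF4, ∀ x, σ x = g • x) : 16 ≤ Fintype.card X := by
  classical
  by_contra hlt
  obtain ⟨D⟩ := OrbitBases.nonempty X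
  have size_pair : ∀ i j, i ≠ j → (D.type i).size + (D.type j).size ≤ 15 := fun i j hij => by
    have := D.sum_size_le {i, j}
    rw [Finset.sum_pair hij] at this
    omega
  have size_triple : ∀ i j k, i ≠ j → i ≠ k → j ≠ k →
      (D.type i).size + (D.type j).size + (D.type k).size ≤ 15 := fun i j k hij hik hjk => by
    have := D.sum_size_le {i, j, k}
    rw [Finset.sum_insert (by simp [hij, hik]), Finset.sum_pair hjk] at this
    omega
  have size_quadruple : ∀ i j k l, i ≠ j → i ≠ k → i ≠ l → j ≠ k → j ≠ l → k ≠ l →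
      (D.type i).size + (D.type j).size + (D.type k).size + (D.type l).size ≤ 15 :=
    fun i j k l hij hik hil hjk hjl hkl => by
      have := D.sum_size_le {i, j, k, l}
      rw [Finset.sum_insert (by simp [hij, hik, hil]), Finset.sum_insert (by simp [hjk, hjl]),
        Finset.sum_pair hkl] at this
      omega
  by_cases h12 : ∃ m, D.type m = twelve
  · obtain ⟨m, hm⟩ := h12
    have hne : ∀ i, D.type i = three → m ≠ i := by
      rintro i hi rfl
      simp [hm] at hi
    refine D.false_of_twelve hinv hfull m hm (fun i hi => ?_) fun i j hi hj => ?_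
    · have := size_pair i m hi
      cases h : D.type i <;> simp [h, hm, size] at this ⊢
    · by_contra hij
      have := size_triple m i j (hne i hi) (hne j hj) hij
      simp [hm, hi, hj, size] at this
  · push Not at h12
    obtain ⟨k, hk⟩ := D.exists_four_or_twelve hinv hfull
    replace hk := hk.resolve_right (h12 k)
    obtain ⟨m, hm⟩ := D.exists_six_or_twelve hinv hfull
    replace hm := hm.resolve_right (h12 m)
    have hmk : m ≠ k := by
      rintro rfl
      simp [hm] at hk
    have hne : ∀ i, D.type i = three → m ≠ i ∧ k ≠ i := by
      refine fun i hi => ⟨?_, ?_⟩ <;> rintro rfl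
      · simp [hm] at hi
      · simp [hk] at hi
    refine D.false_of_four_six hinv hfull k m hk hm (fun i hi => ?_) fun i j hi hj => ?_
    · by_cases hik : i = k
      · rw [hik]
        exact Or.inr (Or.inr hk)
      · have := size_triple i m k hi hik hmk
        have := h12 i
        cases h : D.type i <;> simp_all [size]
    · by_contra hij
      have := size_quadruple m k i j hmk (hne i hi).1 (hne j hj).1 (hne i hi).2 (hne j hj).2 hij
      simp [hm, hk, hi, hj, size] at this

namespace SixteenVertices

/-- The action of `A₄` on `16` points: two orbits `{0, 1, 2}` and `{3, 4, 5}` of size `3`, the orbit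
of pairs in the field with four elements, where `6 + 2 * a + s` stands for `{0, ωᵃ}` (`s = 0`) or its
complement (`s = 1`), and the orbit of the elements `v` of the field, written `12 + v`. -/
def act (g : AffF4) (x : Fin 16) : Fin 16 :=
  if x.val < 3 then Fin.ofNat 16 ((x.val + g.2.val) % 3)
  else if x.val < 6 then Fin.ofNat 16 (3 + (x.val + g.2.val) % 3)
  else if x.val < 12 then
    let a := ((x.val - 6) / 2 + g.2.val) % 3
    let flip := if g.1.val = 0 ∨ g.1.val = a + 1 then 0 else 1
    Fin.ofNat 16 (6 + 2 * a + (x.val + flip) % 2)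
  else Fin.ofNat 16 (12 + (g.1 ^^^ AffF4.rot g.2 (Fin.ofNat 4 (x.val - 12))).val)

/-- The neighbourhoods of the vertices of the graph, as binary numbers. -/
def nbhd : Fin 16 → ℕ :=
  ![3080, 208, 800, 241, 810, 3100, 12298, 49162, 20500, 40980, 36897, 24609,
    58688, 55872, 47488, 30336]

/-- A graph on `16` vertices with automorphism group `A₄`. Field elements form a clique, as do
the points `3, 4, 5`; pairs are joined to their elements, `3 + a` is joined to `a` and to the pairs
of direction `ωᵃ`, and `a + 1` is joined to the pairs of direction `ωᵃ`, where `a` is read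
modulo `3`. -/
def graph : SimpleGraph (Fin 16) where
  Adj x y := (nbhd x).testBit y.val = true
  symm := ⟨by decide +kernel⟩
  loopless := ⟨by decide +kernel⟩

instance : DecidableRel graph.Adj := fun x y =>
  inferInstanceAs (Decidable ((nbhd x).testBit y.val = true))

theorem act_one (x : Fin 16) : act 1 x = x := by revert x; decide +kernel

theorem act_mul (g h : AffF4) (x : Fin 16) : act (g * h) x = act g (act h x) := by
  revert g h x
  decide +kernel

theorem act_injective : ∀ g h, (∀ x, act g x = act h x) → g = h := by decide +kernel

theorem adj_act (g : AffF4) (x y : Fin 16) :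
    graph.Adj (act g x) (act g y) ↔ graph.Adj x y := by
  revert g x y
  decide +kernel

/-- The action of `A₄` by automorphisms of the graph. -/
def toAut : AffF4 →* (graph ≃g graph) where
  toFun g :=
    { toFun := act g
      invFun := act g⁻¹
      left_inv := fun x => by rw [← act_mul, inv_mul_cancel, act_one]
      right_inv := fun x => by rw [← act_mul, mul_inv_cancel, act_one]
      map_rel_iff' := adj_act g _ _ }
  map_one' := RelIso.ext act_one
  map_mul' g h := RelIso.ext (act_mul g h)

theorem toAut_injective : Function.Injective toAut := fun g h e =>
  act_injective g h fun x => congrArg (fun σ : graph ≃g graph => σ x) e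

/-- The possible images of a list of vertices under maps preserving degrees, adjacency and
equality. -/
def images : List (Fin 16) → List (List (Fin 16))
  | [] => [[]]
  | k :: ks => (images ks).flatMap fun l =>
      ((List.finRange 16).filter fun v => graph.degree v = graph.degree k ∧
        ∀ p ∈ ks.zip l, (graph.Adj v p.2 ↔ graph.Adj k p.1) ∧ (v = p.2 ↔ k = p.1)).map (· :: l)

theorem map_mem_images (σ : graph ≃g graph) (ks : List (Fin 16)) : ks.map σ ∈ images ks := by
  induction ks with
  | nil => simp [images]
  | cons k ks ih =>
    simp only [images, List.mem_flatMap, List.mem_map, List.mem_filter]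
    refine ⟨_, ih, σ k, ⟨List.mem_finRange _, ?_⟩, by simp⟩
    rw [decide_eq_true_iff]
    refine ⟨σ.degree_eq k, fun p hp => ?_⟩
    have e : p.2 = σ p.1 := by
      rw [← List.map_id ks, List.map_map, List.zip_map', List.mem_map] at hp
      obtain ⟨a, -, rfl⟩ := hp
      rfl
    rw [e, σ.map_adj_iff, σ.injective.eq_iff]
    exact ⟨Iff.rfl, Iff.rfl⟩

theorem length_images : (images (List.finRange 16).reverse).length = 12 := by decide +kernel

theorem toAut_bijective : Function.Bijective toAut := by
  classical
  have : Finite (graph ≃g graph) := Finite.of_injective _ RelIso.toEquiv_injective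
  have := Fintype.ofFinite (graph ≃g graph)
  refine (Fintype.bijective_iff_injective_and_card _).mpr ⟨toAut_injective,
    le_antisymm (Fintype.card_le_of_injective _ toAut_injective) ?_⟩
  let f : (graph ≃g graph) → List (Fin 16) := fun σ => (List.finRange 16).reverse.map σ
  have hf : Function.Injective f := fun σ τ h =>
    RelIso.ext fun x => List.map_inj_left.mp h x (by simp)
  calc Fintype.card (graph ≃g graph) = (Finset.univ.image f).card :=
        (Finset.card_image_of_injective _ hf).symm
    _ ≤ (images (List.finRange 16).reverse).toFinset.card := Finset.card_le_card fun l hl => by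
        obtain ⟨σ, -, rfl⟩ := Finset.mem_image.mp hl
        exact List.mem_toFinset.mpr (map_mem_images σ _)
    _ ≤ 12 := (List.toFinset_card_le _).trans length_images.le
    _ = Fintype.card AffF4 := by decide

end SixteenVertices

/-- Proposition: the alternating group `A₄` satisfies `α(A₄) = 16`. -/
theorem alpha_A4 : graphAlpha (alternatingGroup (Fin 4)) = 16 := by
  have h16 : 16 ∈ {n : ℕ | ∃ Γ : SimpleGraph (Fin n),
      Nonempty ((Γ ≃g Γ) ≃* alternatingGroup (Fin 4))} :=
    ⟨SixteenVertices.graph, ⟨(MulEquiv.ofBijective _ SixteenVertices.toAut_bijective).symm.trans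
      AffF4.equivAlternating⟩⟩
  refine le_antisymm (Nat.sInf_le h16) (le_csInf ⟨16, h16⟩ ?_)
  rintro n ⟨Γ, ⟨e⟩⟩
  let e' : AffF4 ≃* (Γ ≃g Γ) := AffF4.equivAlternating.trans e.symm
  let _ : MulAction AffF4 (Fin n) :=
    { smul := fun g x => e' g x
      one_smul := fun x => congrArg (fun σ : Γ ≃g Γ => σ x) (map_one e')
      mul_smul := fun g h x => congrArg (fun σ : Γ ≃g Γ => σ x) (map_mul e' g h) }
  have hsmul : ∀ (g : AffF4) (x : Fin n), g • x = e' g x := fun _ _ => rfl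
  have : FaithfulSMul AffF4 (Fin n) := ⟨fun {g h} H => e'.injective (RelIso.ext H)⟩
  have := sixteen_le_card Γ (fun g x y => (e' g).map_adj_iff)
    fun σ => ⟨e'.symm σ, fun x => by rw [hsmul, e'.apply_symm_apply]⟩
  rwa [Fintype.card_fin] at this
end
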